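/- arXiv:2605.18285 — 10 statements merged into one kernel-verified Lean document; each statement's English description precedes it below -/
import Mathlib

section
/- Let ρ be a pre-GSOS law of Σ over B that is natural with respect to ι̂ : Σ*(μΣ) → μΣ and natural with respect to Σ*(beh) : Σ*(μΣ) → Σ*(νB). Then beh is a morphic congruence on the initial algebra (μΣ, ι): there exists a morphism a' : Σ(νB) → νB such that beh ∘ ι = a' ∘ Σ(beh). -/
open CategoryTheory CategoryTheory.Limits

universe v u

/-- Free algebras for an endofunctor `S`: for each object `X`, an `S`-algebra
`(obj X, ι X)` with universal morphism `η X : X ⟶ obj X`, such that every morphism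
`h : X ⟶ A` into an `S`-algebra `(A, a)` has a unique extension `ext a h` to an
algebra morphism. -/
structure FreeAlg {C : Type u} [Category.{v} C] (S : C ⥤ C) where
  obj : C → C
  ι : ∀ X : C, S.obj (obj X) ⟶ obj X
  η : ∀ X : C, X ⟶ obj X
  ext : ∀ {X A : C}, (S.obj A ⟶ A) → (X ⟶ A) → (obj X ⟶ A)
  ext_ι : ∀ {X A : C} (a : S.obj A ⟶ A) (h : X ⟶ A),
    ι X ≫ ext a h = S.map (ext a h) ≫ a
  ext_η : ∀ {X A : C} (a : S.obj A ⟶ A) (h : X ⟶ A), η X ≫ ext a h = h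
  ext_unique : ∀ {X A : C} (a : S.obj A ⟶ A) (h : X ⟶ A) (k : obj X ⟶ A),
    ι X ≫ k = S.map k ≫ a → η X ≫ k = h → k = ext a h

/-- The functorial action `Σ*f := (η_Y ∘ f)*`. -/
def FreeAlg.fmap {C : Type u} [Category.{v} C] {S : C ⥤ C} (F : FreeAlg S)
    {X Y : C} (f : X ⟶ Y) : F.obj X ⟶ F.obj Y :=
  F.ext (F.ι Y) (f ≫ F.η Y)

namespace FreeAlg

variable {C : Type u} [Category.{v} C] {S : C ⥤ C} (F : FreeAlg S)

theorem hom_ext {X A : C} (a : S.obj A ⟶ A) {k l : F.obj X ⟶ A}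
    (hk : F.ι X ≫ k = S.map k ≫ a) (hl : F.ι X ≫ l = S.map l ≫ a)
    (h : F.η X ≫ k = F.η X ≫ l) : k = l :=
  (F.ext_unique a _ k hk h).trans (F.ext_unique a _ l hl rfl).symm

theorem ι_fmap {X Y : C} (f : X ⟶ Y) : F.ι X ≫ F.fmap f = S.map (F.fmap f) ≫ F.ι Y :=
  F.ext_ι _ _

theorem η_fmap {X Y : C} (f : X ⟶ Y) : F.η X ≫ F.fmap f = f ≫ F.η Y :=
  F.ext_η _ _

/-- Evaluation of terms in an algebra is natural with respect to algebra morphisms. -/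
theorem ext_id_comp {A A' : C} {a : S.obj A ⟶ A} {a' : S.obj A' ⟶ A'} {f : A ⟶ A'}
    (hf : a ≫ f = S.map f ≫ a') :
    F.ext a (𝟙 A) ≫ f = F.fmap f ≫ F.ext a' (𝟙 A') := by
  apply F.hom_ext a'
  · rw [← Category.assoc, F.ext_ι, Category.assoc, hf, S.map_comp, Category.assoc]
  · rw [← Category.assoc, F.ι_fmap, Category.assoc, F.ext_ι, S.map_comp, Category.assoc]
  · rw [← Category.assoc, F.ext_η, ← Category.assoc, F.η_fmap, Category.assoc, F.ext_η,
      Category.id_comp, Category.comp_id]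

variable [HasBinaryProducts C]

/-- Uniqueness of primitive recursion along an algebra morphism `f`. -/
theorem primrec_unique {X Y Z : C} {y : S.obj Y ⟶ Y} {f : F.obj X ⟶ Y}
    (hf : F.ι X ≫ f = S.map f ≫ y) (φ : S.obj (Y ⨯ Z) ⟶ Z) {k l : F.obj X ⟶ Z}
    (hk : F.ι X ≫ k = S.map (prod.lift f k) ≫ φ)
    (hl : F.ι X ≫ l = S.map (prod.lift f l) ≫ φ)
    (h : F.η X ≫ k = F.η X ≫ l) : k = l := by
  have key : ∀ m : F.obj X ⟶ Z, F.ι X ≫ m = S.map (prod.lift f m) ≫ φ →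
      F.ι X ≫ prod.lift f m =
        S.map (prod.lift f m) ≫ prod.lift (S.map prod.fst ≫ y) φ := by
    intro m hm
    rw [prod.comp_lift, prod.comp_lift, hm, hf, ← Category.assoc, ← S.map_comp,
      prod.lift_fst]
  have e : prod.lift f k = prod.lift f l :=
    F.hom_ext _ (key k hk) (key l hl) (by rw [prod.comp_lift, prod.comp_lift, h])
  rw [← prod.lift_snd f k, e, prod.lift_snd]

/-- Existence of primitive recursion on free algebras. -/
theorem exists_primrec {X Z : C} (φ : S.obj (F.obj X ⨯ Z) ⟶ Z) (g : X ⟶ Z) :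
    ∃ k : F.obj X ⟶ Z, F.ι X ≫ k = S.map (prod.lift (𝟙 _) k) ≫ φ ∧ F.η X ≫ k = g := by
  let a : S.obj (F.obj X ⨯ Z) ⟶ F.obj X ⨯ Z := prod.lift (S.map prod.fst ≫ F.ι X) φ
  let h := F.ext a (prod.lift (F.η X) g)
  have hι : F.ι X ≫ h = S.map h ≫ a := F.ext_ι _ _
  have hη : F.η X ≫ h = prod.lift (F.η X) g := F.ext_η _ _
  have hfst : h ≫ prod.fst = 𝟙 _ := by
    apply F.hom_ext (F.ι X)
    · rw [← Category.assoc, hι, Category.assoc, prod.lift_fst, S.map_comp, Category.assoc]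
    · simp
    · rw [← Category.assoc, hη, prod.lift_fst, Category.comp_id]
  have hlift : prod.lift (𝟙 _) (h ≫ prod.snd) = h := by
    rw [← hfst, ← prod.comp_lift]; simp
  refine ⟨h ≫ prod.snd, ?_, ?_⟩
  · rw [hlift, ← Category.assoc, hι, Category.assoc, prod.lift_snd]
  · rw [← Category.assoc, hη, prod.lift_snd]

/-- A pre-GSOS law extends any coalgebra `c : X ⟶ B X` to the free algebra on `X`. -/
theorem exists_lift_coalgebra {B : C ⥤ C}
    (rho : ∀ X : C, S.obj (X ⨯ B.obj X) ⟶ B.obj (F.obj X)) {X : C} (c : X ⟶ B.obj X) :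
    ∃ d : F.obj X ⟶ B.obj (F.obj X),
      F.ι X ≫ d = S.map (prod.lift (𝟙 _) d) ≫ rho (F.obj X) ≫ B.map (F.ext (F.ι X) (𝟙 _)) ∧
      F.η X ≫ d = c ≫ B.map (F.η X) :=
  F.exists_primrec _ _

/-- An algebra morphism with respect to which `rho` is natural, and which is a coalgebra
morphism on generators, is a coalgebra morphism between models of `rho`. -/
theorem coalgebra_hom_of_natural {B : C ⥤ C}
    (rho : ∀ X : C, S.obj (X ⨯ B.obj X) ⟶ B.obj (F.obj X)) {X A : C}
    {a : S.obj A ⟶ A} {f : F.obj X ⟶ A} (hf : F.ι X ≫ f = S.map f ≫ a)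
    (hnat : rho (F.obj X) ≫ B.map (F.fmap f) = S.map (prod.map f (B.map f)) ≫ rho A)
    {d : F.obj X ⟶ B.obj (F.obj X)} {c : A ⟶ B.obj A}
    (hd : F.ι X ≫ d =
      S.map (prod.lift (𝟙 _) d) ≫ rho (F.obj X) ≫ B.map (F.ext (F.ι X) (𝟙 _)))
    (hc : a ≫ c = S.map (prod.lift (𝟙 _) c) ≫ rho A ≫ B.map (F.ext a (𝟙 _)))
    (hη : F.η X ≫ d ≫ B.map f = F.η X ≫ f ≫ c) : d ≫ B.map f = f ≫ c := by
  refine F.primrec_unique hf (rho A ≫ B.map (F.ext a (𝟙 _))) ?_ ?_ hη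
  · calc F.ι X ≫ d ≫ B.map f
        = S.map (prod.lift (𝟙 _) d) ≫ (rho (F.obj X) ≫ B.map (F.fmap f)) ≫
            B.map (F.ext a (𝟙 _)) := by
          rw [← Category.assoc, hd]
          simp only [Category.assoc, ← B.map_comp]
          rw [F.ext_id_comp hf]
      _ = S.map (prod.lift f (d ≫ B.map f)) ≫ rho A ≫ B.map (F.ext a (𝟙 _)) := by
          rw [hnat, Category.assoc, ← Category.assoc, ← S.map_comp, prod.lift_map,
            Category.id_comp]
  · rw [← Category.assoc, hf, Category.assoc, hc, ← Category.assoc, ← S.map_comp,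
      prod.comp_lift, Category.comp_id]

end FreeAlg

/-- **Congruence theorem for pre-GSOS laws.**
If a pre-GSOS law `ρ` is natural w.r.t. `ι̂ : Σ*(μΣ) → μΣ` and w.r.t.
`Σ*(beh) : Σ*(μΣ) → Σ*(νB)`, then `beh : μΣ → νB` is a morphic congruence on the
initial algebra `(μΣ, ι)`. -/
theorem stmt0 {C : Type u} [Category.{v} C] [HasBinaryProducts C]
    (S B : C ⥤ C) (F : FreeAlg S)
    -- initial algebra (μΣ, ι)
    (muS : C) (iota : S.obj muS ⟶ muS)
    (hInit : ∀ (A : C) (a : S.obj A ⟶ A), ∃! h : muS ⟶ A, iota ≫ h = S.map h ≫ a)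
    -- final coalgebra (νB, τ)
    (nuB : C) (tau : nuB ⟶ B.obj nuB)
    (hFinal : ∀ (X : C) (c : X ⟶ B.obj X), ∃! h : X ⟶ nuB, h ≫ tau = c ≫ B.map h)
    -- a pre-GSOS law of Σ over B (no naturality assumed)
    (rho : ∀ X : C, S.obj (X ⨯ B.obj X) ⟶ B.obj (F.obj X))
    -- the operational model γ of ρ
    (gamma : muS ⟶ B.obj muS)
    (hgamma : iota ≫ gamma =
      S.map (prod.lift (𝟙 muS) gamma) ≫ rho muS ≫ B.map (F.ext iota (𝟙 muS)))
    -- the behaviour morphism beh : μΣ → νB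
    (beh : muS ⟶ nuB)
    (hbeh : beh ≫ tau = gamma ≫ B.map beh)
    -- ρ is natural w.r.t. ι̂ = (id_{μΣ})*
    (hnat1 : rho (F.obj muS) ≫ B.map (F.fmap (F.ext iota (𝟙 muS))) =
      S.map (prod.map (F.ext iota (𝟙 muS)) (B.map (F.ext iota (𝟙 muS)))) ≫ rho muS)
    -- ρ is natural w.r.t. Σ*(beh)
    (hnat2 : rho (F.obj muS) ≫ B.map (F.fmap (F.fmap beh)) =
      S.map (prod.map (F.fmap beh) (B.map (F.fmap beh))) ≫ rho (F.obj nuB)) :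
    ∃ a' : S.obj nuB ⟶ nuB, iota ≫ beh = S.map beh ≫ a' := by
  obtain ⟨d, hdι, hdη⟩ := F.exists_lift_coalgebra rho gamma
  obtain ⟨d', hdι', hdη'⟩ := F.exists_lift_coalgebra rho tau
  have hiota : d ≫ B.map (F.ext iota (𝟙 muS)) = F.ext iota (𝟙 muS) ≫ gamma := by
    refine F.coalgebra_hom_of_natural rho (F.ext_ι _ _) hnat1 hdι hgamma ?_
    rw [← Category.assoc, hdη, Category.assoc, ← B.map_comp, ← Category.assoc, F.ext_η]
    simp
  have hfmap : d ≫ B.map (F.fmap beh) = F.fmap beh ≫ d' := by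
    refine F.coalgebra_hom_of_natural rho (F.ι_fmap _) hnat2 hdι hdι' ?_
    rw [← Category.assoc, hdη, Category.assoc, ← B.map_comp, ← Category.assoc, F.η_fmap,
      Category.assoc, hdη', B.map_comp, ← Category.assoc, ← Category.assoc, hbeh]
  obtain ⟨b, hb, -⟩ := hFinal _ d'
  have hbeh_ext : F.fmap beh ≫ b = F.ext iota (𝟙 muS) ≫ beh := by
    refine (hFinal _ d).unique ?_ ?_
    · rw [Category.assoc, hb, ← Category.assoc, ← hfmap, Category.assoc, ← B.map_comp]
    · rw [Category.assoc, hbeh, ← Category.assoc, ← hiota, Category.assoc, ← B.map_comp]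
  refine ⟨S.map (F.η nuB) ≫ F.ι nuB ≫ b, ?_⟩
  symm
  calc S.map beh ≫ S.map (F.η nuB) ≫ F.ι nuB ≫ b
      = S.map (F.η muS) ≫ (S.map (F.fmap beh) ≫ F.ι nuB) ≫ b := by
        rw [← Category.assoc, ← S.map_comp, ← F.η_fmap, S.map_comp]
        simp only [Category.assoc]
    _ = S.map (F.η muS) ≫ (F.ι muS ≫ F.ext iota (𝟙 muS)) ≫ beh := by
        rw [← F.ι_fmap, Category.assoc, hbeh_ext, Category.assoc]
    _ = iota ≫ beh := by
        rw [F.ext_ι, Category.assoc, ← Category.assoc, ← S.map_comp, F.ext_η, S.map_id,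
          Category.id_comp]
end

section
/- Let ρ be a pre-GSOS law of Σ over B, let γ : μΣ → B(μΣ) be its operational model (γ ∘ ι = B(ι̂) ∘ ρ_{μΣ} ∘ Σ⟨id_{μΣ}, γ⟩), and let ρ*_{μΣ} be an extension of ρ at μΣ. If ρ is natural w.r.t. ι̂, i.e. B(Σ*(ι̂)) ∘ ρ_{Σ*(μΣ)} = ρ_{μΣ} ∘ Σ(ι̂ × B(ι̂)), then γ ∘ ι̂ = B(ι̂) ∘ ρ*_{μΣ} ∘ Σ*⟨id_{μΣ}, γ⟩. -/
open CategoryTheory CategoryTheory.Limits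

universe v u

/-- The multiplication `μ^{Σ*}_X := (id_{Σ*X})* : Σ*(Σ*X) → Σ*X`. -/
def FreeAlg.mult {C : Type u} [Category.{v} C] {S : C ⥤ C} (F : FreeAlg S)
    (X : C) : F.obj (F.obj X) ⟶ F.obj X :=
  F.ext (F.ι X) (𝟙 (F.obj X))

/-- `ρ*_X` is an extension of a pre-GSOS law `ρ` at `X`. -/
def IsExtension {C : Type u} [Category.{v} C] [HasBinaryProducts C]
    {S B : C ⥤ C} (F : FreeAlg S)
    (rho : ∀ X : C, S.obj (X ⨯ B.obj X) ⟶ B.obj (F.obj X))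
    (X : C) (rhoStar : F.obj (X ⨯ B.obj X) ⟶ B.obj (F.obj X)) : Prop :=
  (F.η (X ⨯ B.obj X) ≫ rhoStar = prod.snd ≫ B.map (F.η X)) ∧
  (F.ι (X ⨯ B.obj X) ≫ rhoStar =
    S.map (prod.lift (F.fmap prod.fst) rhoStar) ≫ rho (F.obj X) ≫ B.map (F.mult X))

namespace FreeAlg

variable {C : Type u} [Category.{v} C] {S : C ⥤ C} (F : FreeAlg S)

theorem fmap_ext {X Y A : C} (f : X ⟶ Y) (a : S.obj A ⟶ A) (h : Y ⟶ A) :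
    F.fmap f ≫ F.ext a h = F.ext a (f ≫ h) := by
  refine F.ext_unique a _ _ ?_ ?_
  · rw [← Category.assoc, ι_fmap, Category.assoc, ext_ι, S.map_comp, Category.assoc]
  · rw [← Category.assoc, η_fmap, Category.assoc, ext_η]

theorem mult_ext {X A : C} (a : S.obj A ⟶ A) (h : X ⟶ A) :
    F.mult X ≫ F.ext a h = F.ext a (F.ext a h) := by
  refine F.ext_unique a _ _ ?_ ?_
  · rw [mult, ← Category.assoc, ext_ι, Category.assoc, ext_ι, S.map_comp, Category.assoc]
  · rw [mult, ← Category.assoc, ext_η, Category.id_comp]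

/-- Evaluation of terms commutes with the multiplication. -/
theorem mult_comp_ext_id {A : C} (a : S.obj A ⟶ A) :
    F.mult A ≫ F.ext a (𝟙 A) = F.fmap (F.ext a (𝟙 A)) ≫ F.ext a (𝟙 A) := by
  rw [mult_ext, fmap_ext, Category.comp_id]

theorem fmap_comp_fmap_eq_id {X Y : C} (f : X ⟶ Y) (g : Y ⟶ X) (h : f ≫ g = 𝟙 X) :
    F.fmap f ≫ F.fmap g = 𝟙 (F.obj X) := by
  conv_lhs => rw [fmap.eq_def F g, fmap_ext, ← Category.assoc, h, Category.id_comp]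
  exact (F.ext_unique _ _ _ (by simp) (by simp)).symm

/-- Primitive recursion: a morphism out of a free algebra is determined by its values on
generators and a recursion that may also use an algebra morphism `e`. -/
theorem hom_ext_of_primrec [HasBinaryProducts C] {X A D : C} (a : S.obj A ⟶ A)
    (d : S.obj (A ⨯ D) ⟶ D) {e : F.obj X ⟶ A} (he : F.ι X ≫ e = S.map e ≫ a)
    {k l : F.obj X ⟶ D}
    (hk : F.ι X ≫ k = S.map (prod.lift e k) ≫ d)
    (hl : F.ι X ≫ l = S.map (prod.lift e l) ≫ d)
    (h : F.η X ≫ k = F.η X ≫ l) : k = l := by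
  have hom : ∀ m : F.obj X ⟶ D, F.ι X ≫ m = S.map (prod.lift e m) ≫ d →
      F.ι X ≫ prod.lift e m =
        S.map (prod.lift e m) ≫ prod.lift (S.map prod.fst ≫ a) d := by
    intro m hm
    rw [prod.comp_lift, prod.comp_lift, he, hm, ← Category.assoc (S.map _) (S.map _),
      ← S.map_comp, prod.lift_fst]
  have key : prod.lift e k = prod.lift e l :=
    F.hom_ext _ (hom k hk) (hom l hl) (by rw [prod.comp_lift, prod.comp_lift, h])
  rw [← prod.lift_snd e k, key, prod.lift_snd]

end FreeAlg

/-- If a pre-GSOS law `ρ` with operational model `γ` is natural w.r.t. `ι̂`, then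
`γ ∘ ι̂ = B(ι̂) ∘ ρ*_{μΣ} ∘ Σ*⟨id, γ⟩`. -/
theorem stmt2 {C : Type u} [Category.{v} C] [HasBinaryProducts C]
    (S B : C ⥤ C) (F : FreeAlg S)
    -- initial algebra (μΣ, ι)
    (muS : C) (iota : S.obj muS ⟶ muS)
    (hInit : ∀ (A : C) (a : S.obj A ⟶ A), ∃! h : muS ⟶ A, iota ≫ h = S.map h ≫ a)
    -- a pre-GSOS law of Σ over B (no naturality assumed)
    (rho : ∀ X : C, S.obj (X ⨯ B.obj X) ⟶ B.obj (F.obj X))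
    -- the operational model γ of ρ
    (gamma : muS ⟶ B.obj muS)
    (hgamma : iota ≫ gamma =
      S.map (prod.lift (𝟙 muS) gamma) ≫ rho muS ≫ B.map (F.ext iota (𝟙 muS)))
    -- an extension of ρ at μΣ
    (rhoStar : F.obj (muS ⨯ B.obj muS) ⟶ B.obj (F.obj muS))
    (hExt : IsExtension F rho muS rhoStar)
    -- ρ is natural w.r.t. ι̂ = (id_{μΣ})*
    (hnat : rho (F.obj muS) ≫ B.map (F.fmap (F.ext iota (𝟙 muS))) =
      S.map (prod.map (F.ext iota (𝟙 muS)) (B.map (F.ext iota (𝟙 muS)))) ≫ rho muS) :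
    F.ext iota (𝟙 muS) ≫ gamma =
      F.fmap (prod.lift (𝟙 muS) gamma) ≫ rhoStar ≫ B.map (F.ext iota (𝟙 muS)) := by
  obtain ⟨hη, hι⟩ := hExt
  have heta := F.ext_η iota (𝟙 muS)
  have hiota := F.ext_ι iota (𝟙 muS)
  have hmult := F.mult_comp_ext_id iota
  generalize F.ext iota (𝟙 muS) = e at *
  refine F.hom_ext_of_primrec iota (rho muS ≫ B.map e) hiota ?_ ?_ ?_
  · rw [← Category.assoc, hiota, Category.assoc, hgamma, ← Category.assoc, ← S.map_comp,
      prod.comp_lift, Category.comp_id]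
  · have hlift : F.fmap (prod.lift (𝟙 muS) gamma) ≫
        prod.lift (F.fmap prod.fst) rhoStar ≫ prod.map e (B.map e) =
          prod.lift e (F.fmap (prod.lift (𝟙 muS) gamma) ≫ rhoStar ≫ B.map e) := by
      rw [prod.lift_map, prod.comp_lift, ← Category.assoc,
        F.fmap_comp_fmap_eq_id _ _ (prod.lift_fst _ _), Category.id_comp]
    calc
      _ = S.map (F.fmap (prod.lift (𝟙 muS) gamma)) ≫
            (F.ι (muS ⨯ B.obj muS) ≫ rhoStar) ≫ B.map e := by
        rw [← Category.assoc, F.ι_fmap, Category.assoc, Category.assoc]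
      _ = S.map (F.fmap (prod.lift (𝟙 muS) gamma)) ≫
            S.map (prod.lift (F.fmap prod.fst) rhoStar) ≫
              (rho (F.obj muS) ≫ B.map (F.fmap e)) ≫ B.map e := by
        simp only [hι, Category.assoc, ← B.map_comp, hmult]
      _ = _ := by
        rw [hnat, ← hlift]
        simp only [S.map_comp, Category.assoc]
  · rw [← Category.assoc, heta, Category.id_comp, ← Category.assoc, F.η_fmap,
      Category.assoc, ← Category.assoc (F.η _), hη, Category.assoc, ← B.map_comp, heta,
      B.map_id, Category.comp_id, prod.lift_snd]
end

section
/- Under the stated enrichment assumptions, (μB, η_{B(μB)} ∘ β⁻¹) is a final coalgebra for the Kleisli extension B̄ of B: for every object X and every morphism c : X → T(BX) there is a unique morphism h : X → T(μB) such that T(β⁻¹) ∘ h = μ_{B(μB)} ∘ T(δ^B_{μB}) ∘ T(B(h)) ∘ c. -/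
open CategoryTheory CategoryTheory.Limits

universe v u

/-- `s` is a least upper bound of `D` w.r.t. the relation `le`. -/
def IsLubOn {M : Type*} (le : M → M → Prop) (D : Set M) (s : M) : Prop :=
  (∀ f ∈ D, le f s) ∧ ∀ u, (∀ f ∈ D, le f u) → le s u

/-- A monotone self-map of a pointed dcpo has a fixed point in every subset that contains the
least element and is closed under the map and under nonempty directed least upper bounds. -/
theorem exists_fixedPoint_mem {M : Type*} {le : M → M → Prop} (hrefl : ∀ f, le f f)
    (hantisymm : ∀ f g, le f g → le g f → f = g)
    (htrans : ∀ f g h, le f g → le g h → le f h)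
    {bot : M} (hbot : ∀ f, le bot f)
    (hdcpo : ∀ D : Set M, D.Nonempty → DirectedOn le D → ∃ s, IsLubOn le D s)
    {F : M → M} (hF : ∀ f g, le f g → le (F f) (F g))
    (S : Set M) (hS_bot : bot ∈ S) (hS_map : ∀ f ∈ S, F f ∈ S)
    (hS_lub : ∀ (D : Set M) (s : M), D.Nonempty → DirectedOn le D → IsLubOn le D s →
      D ⊆ S → s ∈ S) :
    ∃ f ∈ S, F f = f := by
  let P : Type _ := {f : M // f ∈ S ∧ le f (F f)}
  obtain ⟨m, hm⟩ := exists_maximal_of_chains_bounded (α := P) (r := fun a b => le a.1 b.1)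
    (by
      intro c hc
      rcases c.eq_empty_or_nonempty with rfl | hne
      · exact ⟨⟨bot, hS_bot, hbot _⟩, by simp⟩
      have hdir : DirectedOn le (Subtype.val '' c) := by
        rintro _ ⟨a, ha, rfl⟩ _ ⟨b, hb, rfl⟩
        by_cases hab : a = b
        · exact ⟨a.1, ⟨a, ha, rfl⟩, hrefl _, hab ▸ hrefl _⟩
        · rcases hc ha hb hab with h | h
          · exact ⟨b.1, ⟨b, hb, rfl⟩, h, hrefl _⟩
          · exact ⟨a.1, ⟨a, ha, rfl⟩, hrefl _, h⟩
      obtain ⟨s, hs⟩ := hdcpo _ (hne.image _) hdir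
      refine ⟨⟨s, hS_lub _ s (hne.image _) hdir hs ?_, hs.2 _ ?_⟩,
        fun a ha => hs.1 _ ⟨a, ha, rfl⟩⟩
      · rintro _ ⟨a, -, rfl⟩
        exact a.2.1
      · rintro _ ⟨a, ha, rfl⟩
        exact htrans _ _ _ a.2.2 (hF _ _ (hs.1 _ ⟨a, ha, rfl⟩)))
    (fun h₁ h₂ => htrans _ _ _ h₁ h₂)
  exact ⟨m.1, m.2.1, hantisymm _ _
    (hm ⟨F m.1, hS_map _ m.2.1, hF _ _ m.2.2⟩ m.2.2) m.2.2⟩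

/-- A map that preserves least upper bounds of nonempty directed sets is monotone. -/
theorem monotone_of_isLubOn_image {M N : Type*} {le : M → M → Prop} {le' : N → N → Prop}
    (hrefl : ∀ f, le f f) {F : M → N}
    (hF : ∀ (D : Set M) (s : M), D.Nonempty → DirectedOn le D → IsLubOn le D s →
      IsLubOn le' (F '' D) (F s))
    (f g : M) (hfg : le f g) : le' (F f) (F g) := by
  have hub : ∀ x ∈ ({f, g} : Set M), le x g := by
    rintro x (rfl | rfl)
    exacts [hfg, hrefl _]
  exact (hF {f, g} g ⟨g, by simp⟩ (fun x hx y hy => ⟨g, by simp, hub x hx, hub y hy⟩)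
    ⟨hub, fun u hu => hu g (by simp)⟩).1 _ ⟨f, by simp, rfl⟩

/-- **Initial algebra–final coalgebra coincidence in Kleisli categories.**
Under the order-enrichment assumptions, `(μB, η ∘ β⁻¹)` is a final coalgebra for the
Kleisli extension `B̄`: for every `c : X → T(BX)` there is a unique `h : X → T(μB)` with
`T(β⁻¹) ∘ h = μ ∘ T(δ^B) ∘ T(Bh) ∘ c`. -/
theorem stmt5 {C : Type u} [Category.{v} C] (T : Monad C) (B : C ⥤ C)
    -- a distributive law δ^B : BT → TB of B over T
    (δB : ∀ X : C, B.obj (T.obj X) ⟶ T.obj (B.obj X))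
    (hδnat : ∀ {X Y : C} (f : X ⟶ Y), B.map (T.map f) ≫ δB Y = δB X ≫ T.map (B.map f))
    (hδunit : ∀ X : C, B.map (T.η.app X) ≫ δB X = T.η.app (B.obj X))
    (hδmul : ∀ X : C,
      B.map (T.μ.app X) ≫ δB X = δB (T.obj X) ≫ T.map (δB X) ≫ T.μ.app (B.obj X))
    -- an initial B-algebra (μB, β), with inverse β⁻¹ (Lambek)
    (muB : C) (β : B.obj muB ⟶ muB)
    (hInit : ∀ (A : C) (a : B.obj A ⟶ A), ∃! h : muB ⟶ A, β ≫ h = B.map h ≫ a)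
    (βinv : muB ⟶ B.obj muB)
    (hβ1 : β ≫ βinv = 𝟙 (B.obj muB)) (hβ2 : βinv ≫ β = 𝟙 muB)
    -- each hom-set C(X, TY) is a partial order ...
    (le : ∀ X Y : C, (X ⟶ T.obj Y) → (X ⟶ T.obj Y) → Prop)
    (hrefl : ∀ {X Y : C} (f : X ⟶ T.obj Y), le X Y f f)
    (hantisymm : ∀ {X Y : C} (f g : X ⟶ T.obj Y), le X Y f g → le X Y g f → f = g)
    (htrans : ∀ {X Y : C} (f g h : X ⟶ T.obj Y), le X Y f g → le X Y g h → le X Y f h)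
    -- ... with a least element ⊥ ...
    (bot : ∀ X Y : C, X ⟶ T.obj Y)
    (hbot : ∀ {X Y : C} (f : X ⟶ T.obj Y), le X Y (bot X Y) f)
    -- ... in which every nonempty directed subset has a least upper bound
    (hdcpo : ∀ {X Y : C} (D : Set (X ⟶ T.obj Y)), D.Nonempty → DirectedOn (le X Y) D →
      ∃ s, IsLubOn (le X Y) D s)
    -- Kleisli composition is left-strict ...
    (hstrict : ∀ {X Y Z : C} (f : X ⟶ T.obj Y),
      f ≫ T.map (bot Y Z) ≫ T.μ.app Z = bot X Z)
    -- ... and preserves lubs of nonempty directed subsets in each argument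
    (hcontPost : ∀ {X Y Z : C} (g : Y ⟶ T.obj Z) (D : Set (X ⟶ T.obj Y))
      (s : X ⟶ T.obj Y), D.Nonempty → DirectedOn (le X Y) D → IsLubOn (le X Y) D s →
      IsLubOn (le X Z) ((fun f => f ≫ T.map g ≫ T.μ.app Z) '' D)
        (s ≫ T.map g ≫ T.μ.app Z))
    (hcontPre : ∀ {X Y Z : C} (f : X ⟶ T.obj Y) (D : Set (Y ⟶ T.obj Z))
      (s : Y ⟶ T.obj Z), D.Nonempty → DirectedOn (le Y Z) D → IsLubOn (le Y Z) D s →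
      IsLubOn (le X Z) ((fun g => f ≫ T.map g ≫ T.μ.app Z) '' D)
        (f ≫ T.map s ≫ T.μ.app Z))
    -- B̄ is locally monotone
    (hmono : ∀ {X Y : C} (f g : X ⟶ T.obj Y), le X Y f g →
      le (B.obj X) (B.obj Y) (B.map f ≫ δB Y) (B.map g ≫ δB Y)) :
    ∀ (X : C) (c : X ⟶ T.obj (B.obj X)),
      ∃! h : X ⟶ T.obj muB,
        h ≫ T.map βinv =
          c ≫ T.map (B.map h ≫ δB muB) ≫ T.μ.app (B.obj muB) := by
  intro X c
  have hpost {X Y Z : C} (g : Y ⟶ T.obj Z) (f f' : X ⟶ T.obj Y) (h : le X Y f f') :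
      le X Z (f ≫ T.map g ≫ T.μ.app Z) (f' ≫ T.map g ≫ T.μ.app Z) :=
    monotone_of_isLubOn_image (F := fun f => f ≫ T.map g ≫ T.μ.app Z) hrefl
      (hcontPost g) f f' h
  have hpre {X Y Z : C} (f : X ⟶ T.obj Y) (g g' : Y ⟶ T.obj Z) (h : le Y Z g g') :
      le X Z (f ≫ T.map g ≫ T.μ.app Z) (f ≫ T.map g' ≫ T.μ.app Z) :=
    monotone_of_isLubOn_image (F := fun g => f ≫ T.map g ≫ T.μ.app Z) hrefl
      (hcontPre f) g g' h
  have hpost_map {X Y Z : C} (g : Y ⟶ Z) (f f' : X ⟶ T.obj Y) (h : le X Y f f') :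
      le X Z (f ≫ T.map g) (f' ≫ T.map g) := by
    simpa using hpost (g ≫ T.η.app Z) f f' h
  have hpre_map {X Y Z : C} (f : X ⟶ Y) (g g' : Y ⟶ T.obj Z) (h : le Y Z g g') :
      le X Z (f ≫ g) (f ≫ g') := by
    have key (k : Y ⟶ T.obj Z) :
        (f ≫ T.η.app Y) ≫ T.map k ≫ T.μ.app Z = f ≫ k := by
      have := T.η.naturality k
      dsimp at this
      rw [Category.assoc, ← reassoc_of% this, T.left_unit]
      exact congrArg (f ≫ ·) (Category.comp_id k)
    simpa only [key] using hpre (f ≫ T.η.app Y) g g' h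
  let Φ : (X ⟶ T.obj muB) → (X ⟶ T.obj muB) := fun h =>
    (c ≫ T.map (B.map h ≫ δB muB) ≫ T.μ.app (B.obj muB)) ≫ T.map β
  let Ψ : (muB ⟶ T.obj muB) → (muB ⟶ T.obj muB) := fun g =>
    βinv ≫ (B.map g ≫ δB muB) ≫ T.map β
  have hΦ (f g) (h : le X muB f g) : le X muB (Φ f) (Φ g) :=
    hpost_map _ _ _ (hpre _ _ _ (hmono _ _ h))
  have hΨ (f g) (h : le muB muB f g) : le muB muB (Ψ f) (Ψ g) :=
    hpre_map _ _ _ (hpost_map _ _ _ (hmono _ _ h))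
  have hTβ : T.map β ≫ T.map βinv = 𝟙 _ := by rw [← T.map_comp, hβ1, T.map_id]
  have hTβ' : T.map βinv ≫ T.map β = 𝟙 _ := by rw [← T.map_comp, hβ2, T.map_id]
  have fixed_iff (h : X ⟶ T.obj muB) :
      h ≫ T.map βinv = c ≫ T.map (B.map h ≫ δB muB) ≫ T.μ.app (B.obj muB) ↔ Φ h = h := by
    constructor
    · intro e
      dsimp only [Φ]
      rw [← e, Category.assoc, hTβ', Category.comp_id]
    · intro e
      conv_lhs => rw [← e]
      simp only [Φ, Category.assoc, hTβ, Category.comp_id]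
  have fixed_eq_unit (g : muB ⟶ T.obj muB) (hg : Ψ g = g) : g = T.η.app muB := by
    refine (hInit (T.obj muB) (δB muB ≫ T.map β)).unique ?_ ?_
    · conv_lhs => rw [← hg]
      simp only [Ψ, reassoc_of% hβ1, Category.assoc]
    · rw [reassoc_of% (hδunit muB)]
      exact T.η.naturality β
  have comp_step (h : X ⟶ T.obj muB)
      (hh : h ≫ T.map βinv = c ≫ T.map (B.map h ≫ δB muB) ≫ T.μ.app (B.obj muB))
      (g : muB ⟶ T.obj muB) :
      h ≫ T.map (Ψ g) ≫ T.μ.app muB = Φ (h ≫ T.map g ≫ T.μ.app muB) := by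
    have hμ {Y Z : C} (k : Y ⟶ Z) :
        T.map (T.map k) ≫ T.μ.app Z = T.μ.app Y ≫ T.map k := T.μ.naturality k
    have hext : B.map (h ≫ T.map g ≫ T.μ.app muB) ≫ δB muB =
        (B.map h ≫ δB muB) ≫ T.map (B.map g ≫ δB muB) ≫ T.μ.app (B.obj muB) := by
      simp only [B.map_comp, T.map_comp, Category.assoc, hδmul]
      rw [reassoc_of% (hδnat g)]
    simp only [Φ, Ψ, hext]
    rw [T.map_comp βinv, Category.assoc, reassoc_of% hh, T.map_comp _ (T.map β),
      Category.assoc, hμ, T.map_comp (B.map h ≫ δB muB), T.map_comp (T.map _)]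
    simp only [Category.assoc, T.assoc]
    rw [reassoc_of% (hμ (B.map g ≫ δB muB))]
  have fixed_le (h h' : X ⟶ T.obj muB)
      (hh : h ≫ T.map βinv = c ≫ T.map (B.map h ≫ δB muB) ≫ T.μ.app (B.obj muB))
      (hh' : Φ h' = h') : le X muB h h' := by
    obtain ⟨g, hgS, hg⟩ := exists_fixedPoint_mem hrefl hantisymm htrans hbot hdcpo hΨ
      {g | le X muB (h ≫ T.map g ≫ T.μ.app muB) h'}
      (by simpa only [Set.mem_ofPred_eq, hstrict] using hbot h')
      (fun g hg => by
        simp only [Set.mem_ofPred_eq, comp_step h hh]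
        exact hh' ▸ hΦ _ _ hg)
      (fun D s hne hdir hs hD => (hcontPre h D s hne hdir hs).2 _ (by
        rintro _ ⟨g, hg, rfl⟩
        exact hD hg))
    obtain rfl := fixed_eq_unit g hg
    simpa using hgS
  obtain ⟨h, -, hh⟩ := exists_fixedPoint_mem hrefl hantisymm htrans hbot hdcpo hΦ
    Set.univ trivial (fun _ _ => trivial) (fun _ _ _ _ _ _ => trivial)
  refine ⟨h, (fixed_iff h).2 hh, fun h' hh' => hantisymm _ _ (fixed_le _ _ hh' hh) ?_⟩
  exact fixed_le _ _ ((fixed_iff h).2 hh) ((fixed_iff h').1 hh')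
end

section
/- Let C be a category with a terminal object 1 and equalizers, and let T be a monad on C with unit η and multiplication μ. Then there exist a monad (T₊, η₊, μ₊) on C and a monad morphism i : T₊ → T (a natural transformation with i ∘ η₊ = η and i_X ∘ (μ₊)_X = μ_X ∘ T(i_X) ∘ i_{T₊X} for all X) such that for every object X the component i_X : T₊X → TX is an equalizer of the parallel pair T(!_X), η_1 ∘ !_{TX} : TX → T1; moreover T₊ is affine, i.e. T₊1 is a terminal object of C. -/
open CategoryTheory CategoryTheory.Limits

universe v u

namespace CategoryTheory.Monad

variable {C : Type u} [Category.{v} C] [HasTerminal C] [HasEqualizers C] (T : Monad C)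

/-- The object part of the affine part of a monad. -/
noncomputable def affineObj (X : C) : C :=
  equalizer (T.map (terminal.from X)) (terminal.from (T.obj X) ≫ T.η.app (⊤_ C))

/-- The inclusion of the affine part of a monad into the monad. -/
noncomputable def affineι (X : C) : T.affineObj X ⟶ T.obj X :=
  equalizer.ι _ _

instance (X : C) : Mono (T.affineι X) :=
  inferInstanceAs (Mono (equalizer.ι _ _))

lemma affineι_map_from (X : C) :
    T.affineι X ≫ T.map (terminal.from X) = terminal.from _ ≫ T.η.app (⊤_ C) := by
  refine (equalizer.condition _ _).trans ?_
  rw [← Category.assoc, terminal.comp_from]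
  rfl

section Lift

variable {W X : C} (g : W ⟶ T.obj X)
  (h : g ≫ T.map (terminal.from X) = terminal.from W ≫ T.η.app (⊤_ C))

/-- Lift a morphism into `T X` to the affine part of `T`. -/
noncomputable def affineLift : W ⟶ T.affineObj X :=
  equalizer.lift g (by rw [h, ← Category.assoc, terminal.comp_from])

@[simp]
lemma affineLift_ι : T.affineLift g h ≫ T.affineι X = g :=
  equalizer.lift_ι _ _

end Lift

/-- The action of the affine part of a monad on morphisms. -/
noncomputable def affineMap {X Y : C} (f : X ⟶ Y) : T.affineObj X ⟶ T.affineObj Y :=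
  T.affineLift (T.affineι X ≫ T.map f) (by
    rw [Category.assoc, ← T.map_comp, terminal.comp_from, affineι_map_from])

@[simp]
lemma affineMap_ι {X Y : C} (f : X ⟶ Y) :
    T.affineMap f ≫ T.affineι Y = T.affineι X ≫ T.map f :=
  T.affineLift_ι _ _

@[simp]
lemma affineMap_ι_assoc {X Y Z : C} (f : X ⟶ Y) (g : T.obj Y ⟶ Z) :
    T.affineMap f ≫ T.affineι Y ≫ g = T.affineι X ≫ T.map f ≫ g := by
  rw [← Category.assoc, affineMap_ι, Category.assoc]

/-- The unit of the affine part of a monad. -/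
noncomputable def affineη (X : C) : X ⟶ T.affineObj X :=
  T.affineLift (T.η.app X) (T.η.naturality (terminal.from X)).symm

@[simp]
lemma affineη_ι (X : C) : T.affineη X ≫ T.affineι X = T.η.app X :=
  T.affineLift_ι _ _

@[simp]
lemma affineη_ι_assoc {X Z : C} (g : T.obj X ⟶ Z) :
    T.affineη X ≫ T.affineι X ≫ g = T.η.app X ≫ g := by
  rw [← Category.assoc, affineη_ι]

lemma affineι_map_affineι_μ_map_from (X : C) :
    (T.affineι (T.affineObj X) ≫ T.map (T.affineι X) ≫ T.μ.app X) ≫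
      T.map (terminal.from X) = terminal.from _ ≫ T.η.app (⊤_ C) := by
  rw [Category.assoc, Category.assoc, ← T.mu_naturality, ← T.map_comp_assoc,
    affineι_map_from, T.map_comp_assoc, T.right_unit, ← affineι_map_from]
  exact congrArg _ (Category.comp_id _)

/-- The multiplication of the affine part of a monad. -/
noncomputable def affineμ (X : C) : T.affineObj (T.affineObj X) ⟶ T.affineObj X :=
  T.affineLift (T.affineι (T.affineObj X) ≫ T.map (T.affineι X) ≫ T.μ.app X)
    (T.affineι_map_affineι_μ_map_from X)

@[simp]
lemma affineμ_ι (X : C) : T.affineμ X ≫ T.affineι X =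
    T.affineι (T.affineObj X) ≫ T.map (T.affineι X) ≫ T.μ.app X :=
  T.affineLift_ι _ _

@[simp]
lemma affineμ_ι_assoc {X Z : C} (g : T.obj X ⟶ Z) :
    T.affineμ X ≫ T.affineι X ≫ g =
      T.affineι (T.affineObj X) ≫ T.map (T.affineι X) ≫ T.μ.app X ≫ g := by
  rw [← Category.assoc, affineμ_ι, Category.assoc, Category.assoc]

lemma affineη_naturality {X Y : C} (f : X ⟶ Y) :
    f ≫ T.affineη Y = T.affineη X ≫ T.affineMap f := by
  simp [← cancel_mono (T.affineι _), T.unit_naturality]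

lemma affineμ_naturality {X Y : C} (f : X ⟶ Y) :
    T.affineMap (T.affineMap f) ≫ T.affineμ Y = T.affineμ X ≫ T.affineMap f := by
  simp only [← cancel_mono (T.affineι _), Category.assoc, affineμ_ι, affineMap_ι,
    affineMap_ι_assoc, affineμ_ι_assoc, ← T.mu_naturality]
  simp only [← T.map_comp_assoc, affineMap_ι]

lemma affineμ_assoc (X : C) :
    T.affineMap (T.affineμ X) ≫ T.affineμ X = T.affineμ (T.affineObj X) ≫ T.affineμ X := by
  simp only [← cancel_mono (T.affineι _), Category.assoc, affineμ_ι,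
    affineMap_ι_assoc, affineμ_ι_assoc, ← T.mu_naturality_assoc, ← T.assoc]
  simp only [← T.map_comp_assoc, affineμ_ι]

lemma affineη_affineμ (X : C) :
    T.affineη (T.affineObj X) ≫ T.affineμ X = 𝟙 _ := by
  rw [← cancel_mono (T.affineι _), Category.assoc, affineμ_ι, affineη_ι_assoc,
    Category.id_comp]
  refine (unit_naturality_assoc C T (T.affineι X) (T.μ.app X)).symm.trans ?_
  rw [T.left_unit]
  exact Category.comp_id _

lemma affineMap_affineη_affineμ (X : C) :
    T.affineMap (T.affineη X) ≫ T.affineμ X = 𝟙 _ := by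
  rw [← cancel_mono (T.affineι _), Category.assoc, affineμ_ι, affineMap_ι_assoc,
    ← T.map_comp_assoc, affineη_ι, T.right_unit, Category.id_comp]
  exact Category.comp_id _

/-- The affine part of a monad. -/
noncomputable def affinePart : Monad C where
  obj := T.affineObj
  map := T.affineMap
  map_id X := by simp [← cancel_mono (T.affineι _)]
  map_comp f g := by simp [← cancel_mono (T.affineι _)]
  η := { app := T.affineη, naturality := fun _ _ => T.affineη_naturality }
  μ := { app := T.affineμ, naturality := fun _ _ => T.affineμ_naturality }
  assoc := T.affineμ_assoc
  left_unit := T.affineη_affineμ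
  right_unit := T.affineMap_affineη_affineμ

/-- The inclusion of the affine part of a monad, as a natural transformation. -/
noncomputable def affineInclusion : T.affinePart.toFunctor ⟶ T.toFunctor where
  app := T.affineι
  naturality _ _ := T.affineMap_ι

/-- The affine part of a monad preserves the terminal object. -/
noncomputable def affineObjTerminalIsTerminal : IsTerminal (T.affineObj (⊤_ C)) :=
  IsTerminal.ofUniqueHom (fun W => terminal.from W ≫ T.affineη _) (fun W k => by
    have h := T.affineι_map_from (⊤_ C)
    rw [Subsingleton.elim (terminal.from (⊤_ C)) (𝟙 _), T.map_id, Category.comp_id] at h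
    rw [← cancel_mono (T.affineι _), Category.assoc, affineη_ι, h, ← Category.assoc,
      terminal.comp_from])

end CategoryTheory.Monad

/-- **The affine part of a monad.**
For a monad `T` on a category with a terminal object and equalizers, there are a monad
`T₊` and a monad morphism `i : T₊ → T` such that each `i_X : T₊X → TX` is an equalizer
of `T(!_X)` and `η_1 ∘ !_{TX} : TX → T1`; moreover `T₊` is affine, i.e. `T₊1` is
terminal. -/
theorem stmt8 {C : Type u} [Category.{v} C] [HasTerminal C] [HasEqualizers C]
    (T : Monad C) :
    ∃ (Tp : Monad C) (i : Tp.toFunctor ⟶ T.toFunctor),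
      -- i is a monad morphism
      (∀ X : C, Tp.η.app X ≫ i.app X = T.η.app X) ∧
      (∀ X : C, Tp.μ.app X ≫ i.app X =
        i.app (Tp.obj X) ≫ T.map (i.app X) ≫ T.μ.app X) ∧
      -- each i_X is an equalizer of T(!_X) and η_1 ∘ !_{TX}
      (∀ X : C, i.app X ≫ T.map (terminal.from X) =
        i.app X ≫ terminal.from (T.obj X) ≫ T.η.app (⊤_ C)) ∧
      (∀ (X W : C) (g : W ⟶ T.obj X),
        g ≫ T.map (terminal.from X) = g ≫ terminal.from (T.obj X) ≫ T.η.app (⊤_ C) →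
        ∃! k : W ⟶ Tp.obj X, k ≫ i.app X = g) ∧
      -- T₊ is affine: T₊1 is a terminal object
      Nonempty (IsTerminal (Tp.obj (⊤_ C))) := by
  refine ⟨T.affinePart, T.affineInclusion, T.affineη_ι, T.affineμ_ι,
    fun X => equalizer.condition _ _, fun X W g h => ?_, ⟨T.affineObjTerminalIsTerminal⟩⟩
  exact ⟨equalizer.lift g h, equalizer.lift_ι g h, fun k hk =>
    equalizer.hom_ext (hk.trans (equalizer.lift_ι g h).symm)⟩
end

section
/- Let C be a category with a terminal object and equalizers, T a monad on C, and let (T₊, η₊, μ₊) be a monad together with a monad morphism i : T₊ → T such that each component i_X : T₊X → TX is an equalizer of T(!_X) and η_1 ∘ !_{TX} : TX → T1. Let Σ be an endofunctor on C with a distributive law δ^Σ : ΣT → TΣ over T. Then there exists a distributive law δ^{Σ+} : ΣT₊ → T₊Σ of Σ over the monad T₊ (a natural transformation with δ^{Σ+}_X ∘ Σ((η₊)_X) = (η₊)_{ΣX} and δ^{Σ+}_X ∘ Σ((μ₊)_X) = (μ₊)_{ΣX} ∘ T₊(δ^{Σ+}_X) ∘ δ^{Σ+}_{T₊X}) such that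 i_{ΣX} ∘ δ^{Σ+}_X = δ^Σ_X ∘ Σ(i_X) for every object X. -/
open CategoryTheory CategoryTheory.Limits

universe v u

/-- **Restriction of a distributive law to the affine part of a monad.**
Given a monad morphism `i : T₊ → T` whose components are equalizers of `T(!)` and
`η_1 ∘ !`, every distributive law `δ^Σ : ΣT → TΣ` restricts to a distributive law
`δ^{Σ+} : ΣT₊ → T₊Σ` with `i ∘ δ^{Σ+} = δ^Σ ∘ Σ(i)`. -/
theorem stmt9 {C : Type u} [Category.{v} C] [HasTerminal C] [HasEqualizers C]
    (T Tp : Monad C) (i : Tp.toFunctor ⟶ T.toFunctor)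
    -- i is a monad morphism
    (hiη : ∀ X : C, Tp.η.app X ≫ i.app X = T.η.app X)
    (hiμ : ∀ X : C, Tp.μ.app X ≫ i.app X =
      i.app (Tp.obj X) ≫ T.map (i.app X) ≫ T.μ.app X)
    -- each i_X is an equalizer of T(!_X) and η_1 ∘ !_{TX}
    (hfork : ∀ X : C, i.app X ≫ T.map (terminal.from X) =
      i.app X ≫ terminal.from (T.obj X) ≫ T.η.app (⊤_ C))
    (heq : ∀ (X W : C) (g : W ⟶ T.obj X),
      g ≫ T.map (terminal.from X) = g ≫ terminal.from (T.obj X) ≫ T.η.app (⊤_ C) →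
      ∃! k : W ⟶ Tp.obj X, k ≫ i.app X = g)
    -- an endofunctor Σ with a distributive law δ^Σ : ΣT → TΣ over T
    (S : C ⥤ C)
    (δS : ∀ X : C, S.obj (T.obj X) ⟶ T.obj (S.obj X))
    (hδSnat : ∀ {X Y : C} (f : X ⟶ Y), S.map (T.map f) ≫ δS Y = δS X ≫ T.map (S.map f))
    (hδSunit : ∀ X : C, S.map (T.η.app X) ≫ δS X = T.η.app (S.obj X))
    (hδSmul : ∀ X : C,
      S.map (T.μ.app X) ≫ δS X = δS (T.obj X) ≫ T.map (δS X) ≫ T.μ.app (S.obj X)) :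
    ∃ δSp : ∀ X : C, S.obj (Tp.obj X) ⟶ Tp.obj (S.obj X),
      -- δ^{Σ+} is a distributive law of Σ over T₊ ...
      (∀ {X Y : C} (f : X ⟶ Y),
        S.map (Tp.map f) ≫ δSp Y = δSp X ≫ Tp.map (S.map f)) ∧
      (∀ X : C, S.map (Tp.η.app X) ≫ δSp X = Tp.η.app (S.obj X)) ∧
      (∀ X : C, S.map (Tp.μ.app X) ≫ δSp X =
        δSp (Tp.obj X) ≫ Tp.map (δSp X) ≫ Tp.μ.app (S.obj X)) ∧
      -- ... restricting δ^Σ along i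
      (∀ X : C, δSp X ≫ i.app (S.obj X) = S.map (i.app X) ≫ δS X) := by
  have i_cancel : ∀ {X W : C} {f g : W ⟶ Tp.obj X},
      f ≫ i.app X = g ≫ i.app X → f = g := by
    intro X W f g h
    exact (heq X W (g ≫ i.app X)
      (by simp only [Category.assoc]; rw [hfork X])).unique h rfl
  have restrict_fork : ∀ X : C,
      (S.map (i.app X) ≫ δS X) ≫ T.map (terminal.from (S.obj X)) =
        (S.map (i.app X) ≫ δS X) ≫ terminal.from (T.obj (S.obj X)) ≫ T.η.app (⊤_ C) := by
    intro X
    have h_terminal : terminal.from (S.obj X) =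
        S.map (terminal.from X) ≫ terminal.from (S.obj (⊤_ C)) := Subsingleton.elim _ _
    have h_unit : T.η.app (S.obj (⊤_ C)) ≫ T.map (terminal.from (S.obj (⊤_ C))) =
        terminal.from (S.obj (⊤_ C)) ≫ T.η.app (⊤_ C) :=
      (T.η.naturality (terminal.from (S.obj (⊤_ C)))).symm
    calc
      _ = S.map (i.app X) ≫ (δS X ≫ T.map (S.map (terminal.from X))) ≫
          T.map (terminal.from (S.obj (⊤_ C))) := by
        rw [h_terminal, T.map_comp]; simp only [Category.assoc]
      _ = S.map (i.app X ≫ T.map (terminal.from X)) ≫ δS (⊤_ C) ≫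
          T.map (terminal.from (S.obj (⊤_ C))) := by
        rw [← hδSnat, S.map_comp]; simp only [Category.assoc]
      _ = S.map (i.app X ≫ terminal.from (T.obj X)) ≫
          (S.map (T.η.app (⊤_ C)) ≫ δS (⊤_ C)) ≫
          T.map (terminal.from (S.obj (⊤_ C))) := by
        rw [hfork X]; simp only [S.map_comp, Category.assoc]
      _ = S.map (i.app X ≫ terminal.from (T.obj X)) ≫
          terminal.from (S.obj (⊤_ C)) ≫ T.η.app (⊤_ C) := by
        rw [hδSunit]; exact congrArg _ h_unit
      _ = _ := by
        rw [← Category.assoc, ← Category.assoc]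
        exact congrArg (· ≫ T.η.app (⊤_ C)) (terminal.hom_ext _ _)
  choose δSp hδSp _ using fun X => heq (S.obj X) (S.obj (Tp.obj X)) _ (restrict_fork X)
  refine ⟨δSp, ?_, ?_, ?_, hδSp⟩
  · intro X Y f
    apply i_cancel
    simp only [Category.assoc]
    rw [hδSp, i.naturality, ← Category.assoc (δSp X), hδSp, Category.assoc, ← hδSnat,
      ← Category.assoc, ← Category.assoc, ← S.map_comp, ← S.map_comp, i.naturality]
  · intro X
    apply i_cancel
    refine (Category.assoc _ _ _).trans ?_
    rw [hδSp, ← Category.assoc, ← S.map_comp, hiη, hδSunit]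
    exact (hiη _).symm
  · intro X
    apply i_cancel
    calc
      _ = S.map (Tp.μ.app X ≫ i.app X) ≫ δS X := by
        rw [Category.assoc, hδSp, S.map_comp, Category.assoc]
      _ = S.map (i.app (Tp.obj X)) ≫ S.map (T.map (i.app X)) ≫
          S.map (T.μ.app X) ≫ δS X := by
        rw [hiμ]; simp only [S.map_comp, Category.assoc]
      _ = S.map (i.app (Tp.obj X)) ≫ (S.map (T.map (i.app X)) ≫ δS (T.obj X)) ≫
          T.map (δS X) ≫ T.μ.app (S.obj X) := by
        rw [hδSmul]; simp only [Category.assoc]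
      _ = (S.map (i.app (Tp.obj X)) ≫ δS (Tp.obj X)) ≫
          T.map (S.map (i.app X) ≫ δS X) ≫ T.μ.app (S.obj X) := by
        rw [hδSnat, T.map_comp]; simp only [Category.assoc]
      _ = δSp (Tp.obj X) ≫ (i.app (S.obj (Tp.obj X)) ≫ T.map (δSp X)) ≫
          T.map (i.app (S.obj X)) ≫ T.μ.app (S.obj X) := by
        rw [← hδSp, ← hδSp, T.map_comp]; simp only [Category.assoc]
      _ = δSp (Tp.obj X) ≫ Tp.map (δSp X) ≫ i.app (Tp.obj (S.obj X)) ≫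
          T.map (i.app (S.obj X)) ≫ T.μ.app (S.obj X) := by
        rw [← i.naturality]; simp only [Category.assoc]
      _ = _ := by
        rw [← hiμ]; simp only [Category.assoc]
end

section
/- In the De Simone setting, assume additionally that C has equalizers. Then for every Kleisli morphism p : P → TX that is affine (T(!) ∘ p = η_1 ∘ !), the morphism δ^{Σ*}_X ∘ Σ*(p) : Σ*P → T(Σ*X) is affine as well: T(!) ∘ δ^{Σ*}_X ∘ Σ*(p) = η_1 ∘ !. -/
open CategoryTheory CategoryTheory.Limits

universe v u

theorem FreeAlg.fmap_comp {C : Type u} [Category.{v} C] {S : C ⥤ C} (F : FreeAlg S)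
    {X Y Z : C} (f : X ⟶ Y) (g : Y ⟶ Z) : F.fmap (f ≫ g) = F.fmap f ≫ F.fmap g := by
  symm
  apply F.ext_unique
  · simp only [fmap, ← Category.assoc, F.ext_ι, S.map_comp]
    simp only [Category.assoc, F.ext_ι]
  · simp only [fmap, ← Category.assoc, F.ext_η]
    simp only [Category.assoc, F.ext_η]

/-- **`Σ*` preserves affine Kleisli morphisms.**
In the De Simone setting with equalizers, if `p : P → TX` is affine
(`T(!) ∘ p = η_1 ∘ !`), then so is `δ^{Σ*}_X ∘ Σ*(p) : Σ*P → T(Σ*X)`. -/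
theorem stmt10 {C : Type u} [Category.{v} C] [HasFiniteProducts C]
    [HasFiniteCoproducts C] [HasTerminal C] [HasEqualizers C]
    (T : Monad C) (S : C ⥤ C) (F : FreeAlg S)
    -- distributive law δ^Σ : ΣT → TΣ
    (δS : ∀ X : C, S.obj (T.obj X) ⟶ T.obj (S.obj X))
    (hδSnat : ∀ {X Y : C} (f : X ⟶ Y), S.map (T.map f) ≫ δS Y = δS X ≫ T.map (S.map f))
    (hδSunit : ∀ X : C, S.map (T.η.app X) ≫ δS X = T.η.app (S.obj X))
    (hδSmul : ∀ X : C,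
      S.map (T.μ.app X) ≫ δS X = δS (T.obj X) ≫ T.map (δS X) ≫ T.μ.app (S.obj X))
    -- distributive law δ^{Σ*} : Σ*T → TΣ* extending δ^Σ
    (δSs : ∀ X : C, F.obj (T.obj X) ⟶ T.obj (F.obj X))
    (hδSsnat : ∀ {X Y : C} (f : X ⟶ Y),
      F.fmap (T.map f) ≫ δSs Y = δSs X ≫ T.map (F.fmap f))
    (hδSsunit : ∀ X : C, F.fmap (T.η.app X) ≫ δSs X = T.η.app (F.obj X))
    (hδSsmul : ∀ X : C,
      F.fmap (T.μ.app X) ≫ δSs X = δSs (T.obj X) ≫ T.map (δSs X) ≫ T.μ.app (F.obj X))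
    (hδSsext1 : ∀ X : C, F.η (T.obj X) ≫ δSs X = T.map (F.η X))
    (hδSsext2 : ∀ X : C,
      F.ι (T.obj X) ≫ δSs X = S.map (δSs X) ≫ δS (F.obj X) ≫ T.map (F.ι X))
    -- an affine Kleisli morphism p : P → TX
    {P X : C} (p : P ⟶ T.obj X)
    (hp : p ≫ T.map (terminal.from X) = terminal.from P ≫ T.η.app (⊤_ C)) :
    (F.fmap p ≫ δSs X) ≫ T.map (terminal.from (F.obj X)) =
      terminal.from (F.obj P) ≫ T.η.app (⊤_ C) := by
  have hfrom : terminal.from (F.obj X) =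
      F.fmap (terminal.from X) ≫ terminal.from (F.obj (⊤_ C)) :=
    Subsingleton.elim _ _
  have hnat : T.η.app (F.obj (⊤_ C)) ≫ T.map (terminal.from (F.obj (⊤_ C))) =
      terminal.from (F.obj (⊤_ C)) ≫ T.η.app (⊤_ C) :=
    (T.η.naturality (terminal.from (F.obj (⊤_ C)))).symm
  calc (F.fmap p ≫ δSs X) ≫ T.map (terminal.from (F.obj X))
      = F.fmap p ≫ (δSs X ≫ T.map (F.fmap (terminal.from X))) ≫
          T.map (terminal.from (F.obj (⊤_ C))) := by
        rw [hfrom, T.map_comp]; simp only [Category.assoc]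
    _ = F.fmap (p ≫ T.map (terminal.from X)) ≫ δSs (⊤_ C) ≫
          T.map (terminal.from (F.obj (⊤_ C))) := by
        rw [← hδSsnat, F.fmap_comp]; simp only [Category.assoc]
    _ = F.fmap (terminal.from P) ≫ (F.fmap (T.η.app (⊤_ C)) ≫ δSs (⊤_ C)) ≫
          T.map (terminal.from (F.obj (⊤_ C))) := by
        rw [hp, F.fmap_comp]; simp only [Category.assoc]
    _ = (F.fmap (terminal.from P) ≫ terminal.from (F.obj (⊤_ C))) ≫ T.η.app (⊤_ C) := by
        rw [hδSsunit, hnat, Category.assoc]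
    _ = terminal.from (F.obj P) ≫ T.η.app (⊤_ C) := by
        congr 1
        exact Subsingleton.elim _ _
end

section
/- Let ρ be a pre-De Simone law such that the morphism j_{1,1} ∘ ⟨η_1, η_1⟩ : 1 → T(1+1) is affine and every component ρ_X is affine (T(!) ∘ ρ_X = η_1 ∘ !). Then the operational model γ is affine, i.e. T(!) ∘ γ = η_1 ∘ ! : μΣ → T1, and the trace morphism satisfies T(!) ∘ tr ≤ η_1 ∘ ! in the partial order on C(μΣ, T1). -/
open CategoryTheory CategoryTheory.Limits

universe v u

/-- A Kleisli morphism `p : P → TX` is affine if `T(!) ∘ p = η_1 ∘ !`. -/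
def Affine {C : Type u} [Category.{v} C] [HasTerminal C] (T : Monad C)
    {P X : C} (p : P ⟶ T.obj X) : Prop :=
  p ≫ T.map (terminal.from X) = terminal.from P ≫ T.η.app (⊤_ C)

/-- A monotone self-map of a pointed directed-complete partial order preserving an admissible
predicate has a fixed point satisfying that predicate. -/
theorem exists_fixedPoint_of_admissible {M : Type*} {le : M → M → Prop}
    (hrefl : ∀ f, le f f) (hantisymm : ∀ f g, le f g → le g f → f = g)
    (htrans : ∀ f g h, le f g → le g h → le f h)
    {bot : M} (hbot : ∀ f, le bot f)
    (hdcpo : ∀ D : Set M, D.Nonempty → DirectedOn le D → ∃ s, IsLubOn le D s)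
    {Φ : M → M} (hΦ : ∀ f g, le f g → le (Φ f) (Φ g))
    {P : M → Prop} (hPbot : P bot) (hPstep : ∀ f, P f → P (Φ f))
    (hPlub : ∀ (D : Set M) (s : M), D.Nonempty → DirectedOn le D → IsLubOn le D s →
      (∀ f ∈ D, P f) → P s) :
    ∃ m, Φ m = m ∧ P m := by
  let A := {f : M // P f ∧ le f (Φ f)}
  obtain ⟨m, hm⟩ := exists_maximal_of_chains_bounded (α := A) (r := fun a b => le a.1 b.1)
    (fun c hc => by
      rcases c.eq_empty_or_nonempty with rfl | hne
      · exact ⟨⟨bot, hPbot, hbot _⟩, by simp⟩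
      have hdir : DirectedOn le (Subtype.val '' c) := by
        rintro _ ⟨a, ha, rfl⟩ _ ⟨b, hb, rfl⟩
        by_cases hab : a = b
        · exact ⟨a.1, ⟨a, ha, rfl⟩, hrefl _, hab ▸ hrefl _⟩
        rcases hc ha hb hab with h | h
        · exact ⟨b.1, ⟨b, hb, rfl⟩, h, hrefl _⟩
        · exact ⟨a.1, ⟨a, ha, rfl⟩, hrefl _, h⟩
      obtain ⟨s, hs⟩ := hdcpo _ (hne.image _) hdir
      refine ⟨⟨s, hPlub _ s (hne.image _) hdir hs ?_, hs.2 _ ?_⟩, fun a ha => hs.1 _ ⟨a, ha, rfl⟩⟩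
      · rintro _ ⟨a, _, rfl⟩
        exact a.2.1
      · rintro _ ⟨a, ha, rfl⟩
        exact htrans _ _ _ a.2.2 (hΦ _ _ (hs.1 _ ⟨a, ha, rfl⟩)))
    (fun h₁ h₂ => htrans _ _ _ h₁ h₂)
  exact ⟨m.1, hantisymm _ _ (hm ⟨Φ m.1, hPstep _ m.2.1, hΦ _ _ m.2.2⟩ m.2.2) m.2.2, m.2.1⟩

/-- An element dominated by another is part of a directed pair with the larger one as its least
upper bound. -/
theorem directedOn_pair_and_isLubOn {M : Type*} {le : M → M → Prop} (hrefl : ∀ f, le f f)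
    {f g : M} (h : le f g) : DirectedOn le {f, g} ∧ IsLubOn le {f, g} g := by
  have hle : ∀ x ∈ ({f, g} : Set M), le x g := by
    rintro x (rfl | rfl)
    exacts [h, hrefl _]
  exact ⟨fun x hx y hy => ⟨g, Or.inr rfl, hle x hx, hle y hy⟩, hle, fun _ hu => hu g (Or.inr rfl)⟩

section

variable {C : Type u} [Category.{v} C]

/-- Kleisli composition with a pure morphism. -/
theorem comp_map_pure_mu (T : Monad C) {X Y Z : C} (f : X ⟶ T.obj Y) (g : Y ⟶ Z) :
    f ≫ T.map (g ≫ T.η.app Z) ≫ T.μ.app Z = f ≫ T.map g := by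
  simp

/-- Discarding the output of an affine Kleisli morphism. -/
theorem Affine.map_mu [HasTerminal C] {T : Monad C} {P X : C} {p : P ⟶ T.obj X}
    (hp : Affine T p) :
    T.map p ≫ T.μ.app X ≫ T.map (terminal.from X) = T.map (terminal.from P) := by
  have hμ := T.μ.naturality (terminal.from X)
  simp only [Functor.comp_map] at hμ
  rw [← hμ, ← Category.assoc, ← T.map_comp, hp]
  simp

/-- A distributive law preserves discarding. -/
theorem distrib_map_terminal [HasTerminal C] {T : Monad C} {S : C ⥤ C}
    {δ : ∀ X : C, S.obj (T.obj X) ⟶ T.obj (S.obj X)}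
    (hδ : ∀ {X Y : C} (f : X ⟶ Y), S.map (T.map f) ≫ δ Y = δ X ≫ T.map (S.map f))
    {X Y : C} (f : X ⟶ Y) :
    δ X ≫ T.map (terminal.from (S.obj X)) =
      S.map (T.map f) ≫ δ Y ≫ T.map (terminal.from (S.obj Y)) := by
  rw [← Category.assoc, hδ, Category.assoc, ← T.map_comp, terminal.comp_from]

/-- Lifting a pure morphism along a distributive law and discarding its output. -/
theorem map_pure_distrib_terminal [HasTerminal C] {T : Monad C} {S : C ⥤ C}
    {δ : ∀ X : C, S.obj (T.obj X) ⟶ T.obj (S.obj X)}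
    (hδ : ∀ X : C, S.map (T.η.app X) ≫ δ X = T.η.app (S.obj X)) {X Y : C} (f : X ⟶ Y) :
    S.map (f ≫ T.η.app Y) ≫ δ Y ≫ T.map (terminal.from (S.obj Y)) =
      terminal.from (S.obj X) ≫ T.η.app (⊤_ C) := by
  have hη := T.η.naturality (terminal.from (S.obj Y))
  simp only [Functor.id_map] at hη
  rw [S.map_comp, Category.assoc, ← Category.assoc (S.map (T.η.app Y)), hδ, ← hη,
    ← Category.assoc, terminal.comp_from]

end

/-- If `j_{1,1} ∘ ⟨η_1, η_1⟩` and `ρ` are affine, so is the operational model. -/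
theorem affine_operationalModel {C : Type u} [Category.{v} C] [HasFiniteProducts C]
    [HasFiniteCoproducts C] [HasTerminal C]
    {T : Monad C} {S B : C ⥤ C} {R muS : C} {iota : S.obj muS ⟶ muS}
    (hInit : ∀ (A : C) (a : S.obj A ⟶ A), ∃! h : muS ⟶ A, iota ≫ h = S.map h ≫ a)
    {j : ∀ X Y : C, T.obj X ⨯ T.obj Y ≅ T.obj (X ⨿ Y)}
    (hjnat : ∀ {X X' Y Y' : C} (f : X ⟶ X') (g : Y ⟶ Y'),
      prod.map (T.map f) (T.map g) ≫ (j X' Y').hom =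
        (j X Y).hom ≫ T.map (coprod.map f g))
    {δS : ∀ X : C, S.obj (T.obj X) ⟶ T.obj (S.obj X)}
    (hδSnat : ∀ {X Y : C} (f : X ⟶ Y), S.map (T.map f) ≫ δS Y = δS X ≫ T.map (S.map f))
    (hδSunit : ∀ X : C, S.map (T.η.app X) ≫ δS X = T.η.app (S.obj X))
    {rho : S.obj (muS ⨿ B.obj muS) ⟶ T.obj (B.obj R)} {k : R ⟶ muS}
    {gamma : muS ⟶ T.obj (B.obj muS)}
    (hgamma : iota ≫ gamma =
      S.map (prod.lift (T.η.app muS) gamma) ≫ S.map (j muS (B.obj muS)).hom ≫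
        δS (muS ⨿ B.obj muS) ≫ T.map rho ≫ T.μ.app (B.obj R) ≫ T.map (B.map k))
    (hj11 : Affine T
      (prod.lift (T.η.app (⊤_ C)) (T.η.app (⊤_ C)) ≫ (j (⊤_ C) (⊤_ C)).hom))
    (hrho : Affine T rho) : Affine T gamma := by
  let a : S.obj (T.obj (⊤_ C)) ⟶ T.obj (⊤_ C) :=
    S.map (prod.lift (terminal.from _ ≫ T.η.app (⊤_ C)) (𝟙 _) ≫ (j (⊤_ C) (⊤_ C)).hom) ≫
      δS _ ≫ T.map (terminal.from _)
  have ha : ∀ {X : C} (m : X ⟶ T.obj (⊤_ C)), S.map m ≫ a =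
      S.map (prod.lift (terminal.from X ≫ T.η.app (⊤_ C)) m ≫ (j (⊤_ C) (⊤_ C)).hom) ≫
        δS _ ≫ T.map (terminal.from _) := by
    intro X m
    simp only [a]
    rw [← Category.assoc, ← S.map_comp, ← Category.assoc m, prod.comp_lift, Category.comp_id,
      ← Category.assoc m, terminal.comp_from]
  refine (hInit _ a).unique ?_ ?_
  · have h₁ : iota ≫ gamma ≫ T.map (terminal.from (B.obj muS)) =
        S.map (prod.lift (T.η.app muS) gamma ≫ (j muS (B.obj muS)).hom) ≫
          δS _ ≫ T.map (terminal.from _) := by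
      rw [← Category.assoc, hgamma]
      simp only [Category.assoc]
      rw [← T.map_comp, terminal.comp_from, hrho.map_mu, S.map_comp, Category.assoc]
    have hη : T.η.app muS ≫ T.map (terminal.from muS) = terminal.from muS ≫ T.η.app (⊤_ C) :=
      (T.η.naturality (terminal.from muS)).symm
    rw [h₁, ha, distrib_map_terminal hδSnat
      (coprod.map (terminal.from muS) (terminal.from (B.obj muS))), ← Category.assoc,
      ← S.map_comp, Category.assoc, ← hjnat, ← Category.assoc (prod.lift _ _), prod.lift_map, hη]
  · have h₁ : prod.lift (terminal.from muS ≫ T.η.app (⊤_ C)) (terminal.from muS ≫ T.η.app (⊤_ C)) ≫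
        (j (⊤_ C) (⊤_ C)).hom = terminal.from muS ≫
        prod.lift (T.η.app (⊤_ C)) (T.η.app (⊤_ C)) ≫ (j (⊤_ C) (⊤_ C)).hom := by
      rw [← Category.assoc (terminal.from muS), prod.comp_lift]
    rw [ha, h₁, distrib_map_terminal hδSnat (terminal.from ((⊤_ C) ⨿ (⊤_ C))),
      ← Category.assoc (S.map _) (S.map _), ← S.map_comp, Category.assoc, hj11,
      ← Category.assoc (terminal.from muS), ← Category.assoc iota, terminal.comp_from]
    exact (map_pure_distrib_terminal hδSunit _).symm

/-- **Affineness of the operational model and subaffineness of traces.**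
If `j_{1,1} ∘ ⟨η_1, η_1⟩ : 1 → T(1+1)` and every component `ρ_X` of a pre-De Simone law
are affine, then the operational model `γ` is affine and `T(!) ∘ tr ≤ η_1 ∘ !`. -/
theorem stmt13 {C : Type u} [Category.{v} C] [HasFiniteProducts C]
    [HasFiniteCoproducts C] [HasTerminal C]
    (T : Monad C) (S B : C ⥤ C) (F : FreeAlg S)
    -- initial algebra (μΣ, ι)
    (muS : C) (iota : S.obj muS ⟶ muS)
    (hInit : ∀ (A : C) (a : S.obj A ⟶ A), ∃! h : muS ⟶ A, iota ≫ h = S.map h ≫ a)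
    -- natural isomorphism j : TX × TY ≅ T(X+Y)
    (j : ∀ X Y : C, T.obj X ⨯ T.obj Y ≅ T.obj (X ⨿ Y))
    (hjnat : ∀ {X X' Y Y' : C} (f : X ⟶ X') (g : Y ⟶ Y'),
      prod.map (T.map f) (T.map g) ≫ (j X' Y').hom =
        (j X Y).hom ≫ T.map (coprod.map f g))
    -- distributive law δ^Σ : ΣT → TΣ
    (δS : ∀ X : C, S.obj (T.obj X) ⟶ T.obj (S.obj X))
    (hδSnat : ∀ {X Y : C} (f : X ⟶ Y), S.map (T.map f) ≫ δS Y = δS X ≫ T.map (S.map f))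
    (hδSunit : ∀ X : C, S.map (T.η.app X) ≫ δS X = T.η.app (S.obj X))
    (hδSmul : ∀ X : C,
      S.map (T.μ.app X) ≫ δS X = δS (T.obj X) ≫ T.map (δS X) ≫ T.μ.app (S.obj X))
    -- distributive law δ^B : BT → TB
    (δB : ∀ X : C, B.obj (T.obj X) ⟶ T.obj (B.obj X))
    (hδBnat : ∀ {X Y : C} (f : X ⟶ Y), B.map (T.map f) ≫ δB Y = δB X ≫ T.map (B.map f))
    (hδBunit : ∀ X : C, B.map (T.η.app X) ≫ δB X = T.η.app (B.obj X))
    (hδBmul : ∀ X : C,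
      B.map (T.μ.app X) ≫ δB X = δB (T.obj X) ≫ T.map (δB X) ≫ T.μ.app (B.obj X))
    -- a pre-De Simone law: a natural transformation ρ_X : Σ(X + BX) → TB(Σ*X)
    (rho : ∀ X : C, S.obj (X ⨿ B.obj X) ⟶ T.obj (B.obj (F.obj X)))
    (hrho : ∀ {X Y : C} (f : X ⟶ Y),
      S.map (coprod.map f (B.map f)) ≫ rho Y = rho X ≫ T.map (B.map (F.fmap f)))
    -- the operational model γ of ρ
    (gamma : muS ⟶ T.obj (B.obj muS))
    (hgamma : iota ≫ gamma =
      S.map (prod.lift (T.η.app muS) gamma) ≫ S.map (j muS (B.obj muS)).hom ≫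
        δS (muS ⨿ B.obj muS) ≫ T.map (rho muS) ≫ T.μ.app (B.obj (F.obj muS)) ≫
        T.map (B.map (F.ext iota (𝟙 muS))))
    -- order-enrichment of the Kleisli category
    (le : ∀ X Y : C, (X ⟶ T.obj Y) → (X ⟶ T.obj Y) → Prop)
    (hrefl : ∀ {X Y : C} (f : X ⟶ T.obj Y), le X Y f f)
    (hantisymm : ∀ {X Y : C} (f g : X ⟶ T.obj Y), le X Y f g → le X Y g f → f = g)
    (htrans : ∀ {X Y : C} (f g h : X ⟶ T.obj Y), le X Y f g → le X Y g h → le X Y f h)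
    (bot : ∀ X Y : C, X ⟶ T.obj Y)
    (hbot : ∀ {X Y : C} (f : X ⟶ T.obj Y), le X Y (bot X Y) f)
    (hdcpo : ∀ {X Y : C} (D : Set (X ⟶ T.obj Y)), D.Nonempty → DirectedOn (le X Y) D →
      ∃ s, IsLubOn (le X Y) D s)
    (hstrict : ∀ {X Y Z : C} (f : X ⟶ T.obj Y),
      f ≫ T.map (bot Y Z) ≫ T.μ.app Z = bot X Z)
    (hcontPost : ∀ {X Y Z : C} (g : Y ⟶ T.obj Z) (D : Set (X ⟶ T.obj Y))
      (s : X ⟶ T.obj Y), D.Nonempty → DirectedOn (le X Y) D → IsLubOn (le X Y) D s →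
      IsLubOn (le X Z) ((fun f => f ≫ T.map g ≫ T.μ.app Z) '' D)
        (s ≫ T.map g ≫ T.μ.app Z))
    (hcontPre : ∀ {X Y Z : C} (f : X ⟶ T.obj Y) (D : Set (Y ⟶ T.obj Z))
      (s : Y ⟶ T.obj Z), D.Nonempty → DirectedOn (le Y Z) D → IsLubOn (le Y Z) D s →
      IsLubOn (le X Z) ((fun g => f ≫ T.map g ≫ T.μ.app Z) '' D)
        (f ≫ T.map s ≫ T.μ.app Z))
    -- the Kleisli extension of B is locally monotone
    (hmono : ∀ {X Y : C} (f g : X ⟶ T.obj Y), le X Y f g →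
      le (B.obj X) (B.obj Y) (B.map f ≫ δB Y) (B.map g ≫ δB Y))
    -- initial algebra (μB, β) of B, with β invertible
    (muB : C) (β : B.obj muB ⟶ muB)
    (hBInit : ∀ (A : C) (a : B.obj A ⟶ A), ∃! h : muB ⟶ A, β ≫ h = B.map h ≫ a)
    (βinv : muB ⟶ B.obj muB)
    (hβ1 : β ≫ βinv = 𝟙 (B.obj muB)) (hβ2 : βinv ≫ β = 𝟙 muB)
    -- (μB, η ∘ β⁻¹) is a final coalgebra for the Kleisli extension of B
    (hfinal : ∀ (X : C) (c : X ⟶ T.obj (B.obj X)),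
      ∃! h : X ⟶ T.obj muB,
        h ≫ T.map βinv =
          c ≫ T.map (B.map h ≫ δB muB) ≫ T.μ.app (B.obj muB))
    -- the trace morphism tr : μΣ → T(μB)
    (tr : muS ⟶ T.obj muB)
    (htr : tr ≫ T.map βinv =
      gamma ≫ T.map (B.map tr ≫ δB muB) ≫ T.μ.app (B.obj muB))
    -- j_{1,1} ∘ ⟨η_1, η_1⟩ is affine
    (hj11 : Affine T
      (prod.lift (T.η.app (⊤_ C)) (T.η.app (⊤_ C)) ≫ (j (⊤_ C) (⊤_ C)).hom))
    -- every component ρ_X is affine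
    (hrhoAff : ∀ X : C, Affine T (rho X)) :
    Affine T gamma ∧
      le muS (⊤_ C) (tr ≫ T.map (terminal.from muB))
        (terminal.from muS ≫ T.η.app (⊤_ C)) := by
  have hγ : Affine T gamma :=
    affine_operationalModel hInit hjnat hδSnat hδSunit hgamma hj11 (hrhoAff muS)
  refine ⟨hγ, ?_⟩
  have postMono : ∀ {X Y Z : C} (g : Y ⟶ T.obj Z) (f f' : X ⟶ T.obj Y), le X Y f f' →
      le X Z (f ≫ T.map g ≫ T.μ.app Z) (f' ≫ T.map g ≫ T.μ.app Z) := by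
    intro X Y Z g f f' h
    obtain ⟨hd, hl⟩ := directedOn_pair_and_isLubOn hrefl h
    exact (hcontPost g _ _ ⟨f, Or.inl rfl⟩ hd hl).1 _ ⟨f, Or.inl rfl, rfl⟩
  have preMono : ∀ {X Y Z : C} (f : X ⟶ T.obj Y) (g g' : Y ⟶ T.obj Z), le Y Z g g' →
      le X Z (f ≫ T.map g ≫ T.μ.app Z) (f ≫ T.map g' ≫ T.μ.app Z) := by
    intro X Y Z f g g' h
    obtain ⟨hd, hl⟩ := directedOn_pair_and_isLubOn hrefl h
    exact (hcontPre f _ _ ⟨g, Or.inl rfl⟩ hd hl).1 _ ⟨g, Or.inl rfl, rfl⟩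
  have mapMono : ∀ {X Y Z : C} (g : Y ⟶ Z) (f f' : X ⟶ T.obj Y), le X Y f f' →
      le X Z (f ≫ T.map g) (f' ≫ T.map g) := by
    intro X Y Z g f f' h
    simpa only [comp_map_pure_mu] using postMono (g ≫ T.η.app Z) f f' h
  have bot_map : ∀ {X Y Z : C} (g : Y ⟶ Z), bot X Y ≫ T.map g = bot X Z := by
    intro X Y Z g
    -- both sides factor through Kleisli morphisms out of the initial object
    have hμ := T.μ.naturality g
    simp only [Functor.comp_map] at hμ
    rw [← hstrict (Y := ⊥_ C) (Z := Y) (bot X (⊥_ C)), ← hstrict (Y := ⊥_ C) (Z := Z) (bot X (⊥_ C)),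
      Category.assoc, Category.assoc, ← hμ, ← Category.assoc (T.map _), ← T.map_comp,
      initial.hom_ext (bot (⊥_ C) Y ≫ T.map g) (bot (⊥_ C) Z)]
  obtain ⟨m, hm, hPm⟩ := exists_fixedPoint_of_admissible (M := muS ⟶ T.obj muB) (le := le muS muB)
    hrefl hantisymm htrans hbot hdcpo
    (Φ := fun h => (gamma ≫ T.map (B.map h ≫ δB muB) ≫ T.μ.app (B.obj muB)) ≫ T.map β)
    (fun f g h => mapMono _ _ _ (preMono _ _ _ (hmono _ _ h)))
    (P := fun h => le muS (⊤_ C) (h ≫ T.map (terminal.from muB))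
      (terminal.from muS ≫ T.η.app (⊤_ C)))
    (by rw [bot_map]; exact hbot _)
    (fun h hh => by
      have hstep : le (B.obj muS) (⊤_ C) (B.map h ≫ δB muB ≫ T.map (terminal.from (B.obj muB)))
          (terminal.from _ ≫ T.η.app (⊤_ C)) := by
        have h₁ := mapMono (terminal.from (B.obj (⊤_ C))) _ _ (hmono _ _ hh)
        rw [distrib_map_terminal hδBnat (terminal.from muB), ← Category.assoc, ← B.map_comp]
        rw [Category.assoc, Category.assoc, map_pure_distrib_terminal hδBunit] at h₁
        exact h₁
      have h₂ := preMono gamma _ _ hstep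
      rw [comp_map_pure_mu, hγ] at h₂
      have hμ := T.μ.naturality (terminal.from (B.obj muB))
      simp only [Functor.comp_map] at hμ
      have h₃ : ((gamma ≫ T.map (B.map h ≫ δB muB) ≫ T.μ.app (B.obj muB)) ≫ T.map β) ≫
          T.map (terminal.from muB) = gamma ≫ T.map (B.map h ≫ δB muB ≫
            T.map (terminal.from (B.obj muB))) ≫ T.μ.app (⊤_ C) := by
        rw [Category.assoc, ← T.map_comp, terminal.comp_from]
        simp only [T.map_comp, Category.assoc, hμ]
      rw [h₃]
      exact h₂)
    (fun D s hne hdir hs hD => by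
      have h := (hcontPost (terminal.from muB ≫ T.η.app (⊤_ C)) D s hne hdir hs).2
        (terminal.from muS ≫ T.η.app (⊤_ C))
      rw [comp_map_pure_mu] at h
      refine h ?_
      rintro _ ⟨f, hf, rfl⟩
      simpa only [comp_map_pure_mu] using hD f hf)
  have hm' : m ≫ T.map βinv =
      gamma ≫ T.map (B.map m ≫ δB muB) ≫ T.μ.app (B.obj muB) := by
    conv_lhs => rw [← hm]
    rw [Category.assoc, ← T.map_comp, hβ1, T.map_id, Category.comp_id]
  rw [(hfinal muS gamma).unique htr hm']
  exact hPm
end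

section
/- Let R be a set of De Simone rules and ρ the induced family of maps ρ_X : Σ(X + L×X + 1) → P(L × Σ*X + 1). Then for every type X and every element f(U_1, …, U_n) of Σ(PX + L×PX + 1) in which every occurring set is nonempty (each U_i lying in PX is nonempty, and each U_i = (a, V) with V ∈ PX has V nonempty), the following two subsets of L × Σ*X + 1 coincide: the union over w ∈ ρ_{PX}(f(U_1,…,U_n)) of δ^B_X((id_L × δ^{Σ*}_X + id_1)(w)), and the union over v ∈ δ^Σ_{X+L×X+1}(f(δ^{B₀}_X(U_1), …, δ^{B₀}_X(U_n))) of ρ_X(v). -/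
/-- Terms over a signature `(Op, ar)` with variables from `X`. -/
inductive FreeTerm (Op : Type) (ar : Op → ℕ) (X : Type) : Type
  | var : X → FreeTerm Op ar X
  | op : (f : Op) → (Fin (ar f) → FreeTerm Op ar X) → FreeTerm Op ar X

/-- Number of occurrences of the variable `v` in a term. -/
def occ {Op : Type} {ar : Op → ℕ} {X : Type} [DecidableEq X] :
    FreeTerm Op ar X → X → ℕ
  | .var y, v => if y = v then 1 else 0
  | .op _ u, v => ∑ i, occ (u i) v

/-- A De Simone rule for an `n`-ary operation `f`: premise positions `prem`,
premise labels `plab`, conclusion label `clab`, and an affine target term over the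
variables `y_i` (`Sum.inl i`, for `i ∈ prem`) and `x_j` (`Sum.inr j`, for `j ∉ prem`). -/
structure DSRule (L Op : Type) (ar : Op → ℕ) (f : Op) where
  prem : Set (Fin (ar f))
  plab : Fin (ar f) → L
  clab : L
  target : FreeTerm Op ar (Fin (ar f) ⊕ Fin (ar f))
  wf_y : ∀ i, 0 < occ target (Sum.inl i) → i ∈ prem
  wf_x : ∀ j, 0 < occ target (Sum.inr j) → j ∉ prem
  affine : ∀ v, occ target v ≤ 1

/-- `SubstRel u t t'` : `t'` is obtained from `t` by substituting, according to
`u : Fin n → X ⊕ (L × X) ⊕ Unit`, each `y_i` by the target `v` of the action `u i`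
and each `x_j` by `u j ∈ X`. -/
inductive SubstRel {L Op : Type} {ar : Op → ℕ} {X : Type} {n : ℕ}
    (u : Fin n → X ⊕ (L × X) ⊕ Unit) :
    FreeTerm Op ar (Fin n ⊕ Fin n) → FreeTerm Op ar X → Prop
  | y {i : Fin n} {a : L} {v : X} : u i = Sum.inr (Sum.inl (a, v)) →
      SubstRel u (.var (Sum.inl i)) (.var v)
  | x {j : Fin n} {w : X} : u j = Sum.inl w → SubstRel u (.var (Sum.inr j)) (.var w)
  | op {f : Op} {ts : Fin (ar f) → FreeTerm Op ar (Fin n ⊕ Fin n)}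
      {ws : Fin (ar f) → FreeTerm Op ar X} :
      (∀ k, SubstRel u (ts k) (ws k)) → SubstRel u (.op f ts) (.op f ws)

open Classical in
/-- The natural transformation `ρ_X : Σ(X + L×X + 1) → P(L × Σ*X + 1)` induced by a set
`R` of De Simone rules. -/
noncomputable def rho {L Op : Type} {ar : Op → ℕ}
    (R : ∀ f : Op, Set (DSRule L Op ar f)) (X : Type)
    (e : (f : Op) × (Fin (ar f) → (X ⊕ (L × X) ⊕ Unit))) :
    Set ((L × FreeTerm Op ar X) ⊕ Unit) :=
  if ∃ i, e.2 i = Sum.inr (Sum.inr ()) then {Sum.inr ()}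
  else
    {Sum.inr ()} ∪
      { w | ∃ r ∈ R e.1,
          (∀ i, i ∈ r.prem ↔ ∃ p, e.2 i = Sum.inr (Sum.inl p)) ∧
          (∀ i a v, e.2 i = Sum.inr (Sum.inl (a, v)) → r.plab i = a) ∧
          ∃ t', SubstRel e.2 r.target t' ∧ w = Sum.inl (r.clab, t') }

/-- The distributive law `δ^Σ_Y : Σ(PY) → P(ΣY)`. -/
def dSigma {Op : Type} {ar : Op → ℕ} (Y : Type)
    (e : (f : Op) × (Fin (ar f) → Set Y)) : Set ((f : Op) × (Fin (ar f) → Y)) :=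
  { w | ∃ x : Fin (ar e.1) → Y, (∀ i, x i ∈ e.2 i) ∧ w = ⟨e.1, x⟩ }

/-- The distributive law `δ^{Σ*}_X : Σ*(PX) → P(Σ*X)`. -/
def dSigmaStar {Op : Type} {ar : Op → ℕ} {X : Type} :
    FreeTerm Op ar (Set X) → Set (FreeTerm Op ar X)
  | .var S => { t | ∃ x ∈ S, t = .var x }
  | .op f u => { t | ∃ ws : Fin (ar f) → FreeTerm Op ar X,
      (∀ i, ws i ∈ dSigmaStar (u i)) ∧ t = .op f ws }

/-- The distributive law `δ^B_X : L × PX + 1 → P(L × X + 1)`. -/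
def dB {L X : Type} : (L × Set X) ⊕ Unit → Set ((L × X) ⊕ Unit)
  | Sum.inl (a, S) => { w | ∃ x ∈ S, w = Sum.inl (a, x) }
  | Sum.inr _ => {Sum.inr ()}

/-- The distributive law `δ^{B₀}_X : PX + L×PX + 1 → P(X + L×X + 1)`. -/
def dB0 {L X : Type} : Set X ⊕ (L × Set X) ⊕ Unit → Set (X ⊕ (L × X) ⊕ Unit)
  | Sum.inl S => { w | ∃ x ∈ S, w = Sum.inl x }
  | Sum.inr (Sum.inl (a, S)) => { w | ∃ x ∈ S, w = Sum.inr (Sum.inl (a, x)) }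
  | Sum.inr (Sum.inr _) => {Sum.inr (Sum.inr ())}

/-- The map `(id_L × δ^{Σ*}_X + id_1)` followed by `δ^B`. -/
def midMap {L Op : Type} {ar : Op → ℕ} {X : Type} :
    (L × FreeTerm Op ar (Set X)) ⊕ Unit → Set ((L × FreeTerm Op ar X) ⊕ Unit)
  | Sum.inl (a, t) => dB (Sum.inl (a, dSigmaStar t))
  | Sum.inr u => dB (L := L) (X := FreeTerm Op ar X) (Sum.inr u)

lemma occ_le_occ_op {Op : Type} {ar : Op → ℕ} {X : Type} [DecidableEq X] {f : Op}
    (ts : Fin (ar f) → FreeTerm Op ar X) (k : Fin (ar f)) (v : X) :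
    occ (ts k) v ≤ occ (.op f ts) v := by
  simp only [occ]
  exact Finset.single_le_sum (f := fun k => occ (ts k) v) (fun _ _ => Nat.zero_le _)
    (Finset.mem_univ k)

namespace SubstRel

variable {L Op : Type} {ar : Op → ℕ} {X : Type} {n : ℕ}

/-- A term that admits a substitution along `u` uses at most one of the two variables
`y_i` and `x_i` attached to a position `i`. -/
lemma occ_eq {u : Fin n → X ⊕ (L × X) ⊕ Unit}
    {t : FreeTerm Op ar (Fin n ⊕ Fin n)} {w : FreeTerm Op ar X} (h : SubstRel u t w)
    {v : Fin n ⊕ Fin n} (hv : 0 < occ t v) :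
    v = (u (v.elim id id)).elim (fun _ => .inr (v.elim id id)) (fun _ => .inl (v.elim id id)) := by
  induction h with
  | @y i a x h =>
    obtain rfl : Sum.inl i = v := by by_contra hne; simp [occ, hne] at hv
    simp [h]
  | @x j x h =>
    obtain rfl : Sum.inr j = v := by by_contra hne; simp [occ, hne] at hv
    simp [h]
  | op _ ih =>
    obtain ⟨k, -, hk⟩ := Finset.exists_ne_zero_of_sum_ne_zero
      (by simpa only [occ] using hv.ne')
    exact ih k (Nat.pos_of_ne_zero hk)

lemma congr {u u' : Fin n → X ⊕ (L × X) ⊕ Unit}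
    {t : FreeTerm Op ar (Fin n ⊕ Fin n)} {w : FreeTerm Op ar X} (h : SubstRel u t w)
    (huu' : ∀ v, 0 < occ t v → u (v.elim id id) = u' (v.elim id id)) : SubstRel u' t w := by
  induction h with
  | @y i a x h => exact .y ((huu' (.inl i) (by simp [occ])).symm.trans h)
  | @x j x h => exact .x ((huu' (.inr j) (by simp [occ])).symm.trans h)
  | op _ ih =>
    exact .op fun k => ih k fun v hv => huu' v (hv.trans_le (occ_le_occ_op _ k v))

/-- Substituting chosen elements yields an element of the substituted set-valued term. -/
lemma exists_mem_dSigmaStar {U : Fin n → Set X ⊕ (L × Set X) ⊕ Unit}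
    {x : Fin n → X ⊕ (L × X) ⊕ Unit} (hx : ∀ i, x i ∈ dB0 (U i))
    {t : FreeTerm Op ar (Fin n ⊕ Fin n)} {w : FreeTerm Op ar X} (h : SubstRel x t w) :
    ∃ T, SubstRel U t T ∧ w ∈ dSigmaStar T := by
  induction h with
  | @y i a v h =>
    have hi := hx i
    rcases hU : U i with S | ⟨b, S⟩ | _ <;> simp [hU, h, dB0] at hi
    exact ⟨.var S, .y hU, v, hi.1, rfl⟩
  | @x j v h =>
    have hj := hx j
    rcases hU : U j with S | ⟨b, S⟩ | _ <;> simp [hU, h, dB0] at hj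
    exact ⟨.var S, .x hU, v, hj, rfl⟩
  | op _ ih =>
    choose T hT hw using ih
    exact ⟨.op _ T, .op hT, _, hw, rfl⟩

/-- For affine terms, elements of the substituted set-valued term come from choosing one
element at each position. -/
lemma exists_choice {U : Fin n → Set X ⊕ (L × Set X) ⊕ Unit}
    (hne : ∀ i, (dB0 (U i)).Nonempty)
    {t : FreeTerm Op ar (Fin n ⊕ Fin n)} {T : FreeTerm Op ar (Set X)} (h : SubstRel U t T)
    (haff : ∀ v, occ t v ≤ 1) {w : FreeTerm Op ar X} (hw : w ∈ dSigmaStar T) :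
    ∃ x : Fin n → X ⊕ (L × X) ⊕ Unit, (∀ i, x i ∈ dB0 (U i)) ∧ SubstRel x t w := by
  classical
  choose x₀ hx₀ using hne
  induction h generalizing w with
  | @y i a S h =>
    obtain ⟨s, hs, rfl⟩ := hw
    refine ⟨Function.update x₀ i (.inr (.inl (a, s))), fun j => ?_, .y (a := a) (by simp)⟩
    obtain rfl | hj := eq_or_ne j i
    · simp [h, dB0, hs]
    · simpa [hj] using hx₀ j
  | @x i S h =>
    obtain ⟨s, hs, rfl⟩ := hw
    refine ⟨Function.update x₀ i (.inl s), fun j => ?_, .x (by simp)⟩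
    obtain rfl | hj := eq_or_ne j i
    · simp [h, dB0, hs]
    · simpa [hj] using hx₀ j
  | @op g ts Ts hTs ih =>
    obtain ⟨ws, hws, rfl⟩ := hw
    choose x hx hsub using fun k => ih k (fun v => (occ_le_occ_op ts k v).trans (haff v)) (hws k)
    have huniq {k k' : Fin (ar g)} {v : Fin n ⊕ Fin n} (hv : 0 < occ (ts k) v)
        (hv' : 0 < occ (ts k') v) : k = k' := by
      by_contra hkk
      have h2 : occ (ts k) v + occ (ts k') v ≤ occ (.op g ts) v := by
        simp only [occ]
        rw [← Finset.sum_pair (f := fun k => occ (ts k) v) hkk]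
        exact Finset.sum_le_sum_of_subset (Finset.subset_univ _)
      have := haff v
      omega
    let used (i : Fin n) (k : Fin (ar g)) : Prop := ∃ v, v.elim id id = i ∧ 0 < occ (ts k) v
    refine ⟨fun i => if hi : ∃ k, used i k then x hi.choose i else x₀ i, fun i => ?_,
      .op fun k => (hsub k).congr fun v hv => ?_⟩
    · dsimp only
      split_ifs with hi
      exacts [hx _ i, hx₀ i]
    · have hi : ∃ k, used (v.elim id id) k := ⟨k, v, rfl, hv⟩
      obtain ⟨v', hvv', hv'⟩ := hi.choose_spec
      have hv_eq : v' = v := by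
        rw [(hTs _).occ_eq hv', hvv', ← (hTs k).occ_eq hv]
      rw [dif_pos hi, huniq hv (hv_eq ▸ hv')]

end SubstRel

/-- The rule `r` fires on the argument behaviours `u`. -/
def DSRule.Fires {L Op : Type} {ar : Op → ℕ} {f : Op} (r : DSRule L Op ar f) {X : Type}
    (u : Fin (ar f) → X ⊕ (L × X) ⊕ Unit) : Prop :=
  (∀ i, u i ≠ .inr (.inr ())) ∧ (∀ i, i ∈ r.prem ↔ ∃ p, u i = .inr (.inl p)) ∧
    ∀ i a v, u i = .inr (.inl (a, v)) → r.plab i = a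

lemma mem_rho {L Op : Type} {ar : Op → ℕ} {R : ∀ f : Op, Set (DSRule L Op ar f)} {X : Type}
    {f : Op} {u : Fin (ar f) → X ⊕ (L × X) ⊕ Unit} {w : (L × FreeTerm Op ar X) ⊕ Unit} :
    w ∈ rho R X ⟨f, u⟩ ↔ w = .inr () ∨
      ∃ r ∈ R f, r.Fires u ∧ ∃ t, SubstRel u r.target t ∧ w = .inl (r.clab, t) := by
  unfold rho DSRule.Fires
  split_ifs with h
  · obtain ⟨i, hi⟩ := h
    refine ⟨.inl, ?_⟩
    rintro (h | ⟨r, -, hr, -⟩)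
    exacts [h, (hr.1 i hi).elim]
  · have h' : ∀ i, u i ≠ .inr (.inr ()) := not_exists.mp h
    simp [h', and_assoc]

lemma DSRule.fires_iff_of_mem_dB0 {L Op : Type} {ar : Op → ℕ} {f : Op}
    (r : DSRule L Op ar f) {X : Type} {U : Fin (ar f) → Set X ⊕ (L × Set X) ⊕ Unit}
    {x : Fin (ar f) → X ⊕ (L × X) ⊕ Unit} (hx : ∀ i, x i ∈ dB0 (U i)) :
    r.Fires x ↔ r.Fires U := by
  simp only [DSRule.Fires, ← forall_and]
  refine forall_congr' fun i => ?_
  have hi := hx i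
  rcases hU : U i with S | ⟨b, S⟩ | _ <;> simp only [hU, dB0] at hi
  · obtain ⟨s, -, hs⟩ := hi
    simp [hs]
  · obtain ⟨s, -, hs⟩ := hi
    simp [hs]
  · simp [Set.mem_singleton_iff.mp hi]

/-- **De Simone rules induce De Simone laws.**
For every set `R` of De Simone rules, the induced law `ρ` is natural w.r.t. nonempty-set
valued (i.e. affine) Kleisli morphisms: for every element `f(U_1,…,U_n)` of
`Σ(P₊X + L×P₊X + 1)` the two legs of the naturality square agree. -/
theorem stmt14 {L Op : Type} {ar : Op → ℕ}
    (R : ∀ f : Op, Set (DSRule L Op ar f)) (X : Type)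
    (f : Op) (U : Fin (ar f) → (Set X ⊕ (L × Set X) ⊕ Unit))
    (hne : ∀ i, (∀ S, U i = Sum.inl S → S.Nonempty) ∧
      (∀ a S, U i = Sum.inr (Sum.inl (a, S)) → S.Nonempty)) :
    (⋃ w ∈ rho R (Set X) ⟨f, U⟩, midMap w) =
      (⋃ v ∈ dSigma (X ⊕ (L × X) ⊕ Unit) ⟨f, fun i => dB0 (U i)⟩, rho R X v) := by
  have hdB0 (i) : (dB0 (U i)).Nonempty := by
    rcases hU : U i with S | ⟨a, S⟩ | _
    · obtain ⟨s, hs⟩ := (hne i).1 S hU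
      exact ⟨.inl s, s, hs, rfl⟩
    · obtain ⟨s, hs⟩ := (hne i).2 a S hU
      exact ⟨.inr (.inl (a, s)), s, hs, rfl⟩
    · exact ⟨.inr (.inr ()), rfl⟩
  ext z
  simp only [Set.mem_iUnion, exists_prop]
  constructor
  · rintro ⟨w, hw, hz⟩
    rcases mem_rho.mp hw with rfl | ⟨r, hr, hfire, T, hT, rfl⟩
    · choose x hx using hdB0
      exact ⟨⟨f, x⟩, ⟨x, hx, rfl⟩, mem_rho.mpr (.inl hz)⟩
    · obtain ⟨t, ht, rfl⟩ := hz
      obtain ⟨x, hx, hsub⟩ := hT.exists_choice hdB0 r.affine ht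
      exact ⟨⟨f, x⟩, ⟨x, hx, rfl⟩, mem_rho.mpr
        (.inr ⟨r, hr, (r.fires_iff_of_mem_dB0 hx).mpr hfire, t, hsub, rfl⟩)⟩
  · rintro ⟨_, ⟨x, hx, rfl⟩, hz⟩
    rcases mem_rho.mp hz with rfl | ⟨r, hr, hfire, t, ht, rfl⟩
    · exact ⟨.inr (), mem_rho.mpr (.inl rfl), rfl⟩
    · obtain ⟨T, hT, htT⟩ := ht.exists_mem_dSigmaStar hx
      exact ⟨.inl (r.clab, T), mem_rho.mpr
        (.inr ⟨r, hr, (r.fires_iff_of_mem_dB0 hx).mp hfire, T, hT, rfl⟩), t, htT, rfl⟩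
end

section
/- Let R be a set of weighted De Simone rules whose operational model γ is probabilistic, i.e. for every closed term t the total mass ∑ over u ∈ (L × Tm) ⊕ Unit of γ(t)(u) equals 1. Then the induced law ρ is natural w.r.t. distribution-valued arguments: for every type X and every element f(U_1, …, U_n) of Σ(DX ⊕ (L × DX) ⊕ Unit) (each weight-function component of each U_i is a probability distribution), the two functions (L × Σ*X) ⊕ Unit → [0,∞] obtained by applying μ^W ∘ W(δ^B_X) ∘ W((id_L × δ^{Σ*}_X) ⊕ id) ∘ ρ_{WX} and μ^W ∘ W(ρ_X) ∘ δ^Σ ∘ Σ(δ^{B₀}_X) to f(U_1, …, U_n) coincide. -/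
open scoped ENNReal

/-- Closed terms over a signature `(Op, ar)`. -/
inductive Tm (Op : Type) (ar : Op → ℕ) : Type
  | op : (f : Op) → (Fin (ar f) → Tm Op ar) → Tm Op ar

/-- Substitution of closed terms for variables. -/
def substC {Op : Type} {ar : Op → ℕ} {V : Type} (σ : V → Tm Op ar) :
    FreeTerm Op ar V → Tm Op ar
  | .var v => σ v
  | .op f u => .op f (fun i => substC σ (u i))

open Classical in
/-- The Dirac weight function `δ_x`. -/
noncomputable def dirac {α : Type*} (x w : α) : ℝ≥0∞ := if w = x then 1 else 0

/-- The action of the weight monad `W` on `h : X → Y`: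
`W(h)(φ)(y) = ∑' over x with h(x) = y of φ(x)`. -/
noncomputable def Wmap {X Y : Type*} (h : X → Y) (φ : X → ℝ≥0∞) : Y → ℝ≥0∞ :=
  fun y => ∑' x : { x : X // h x = y }, φ x.1

/-- The multiplication of the weight monad: `μ^W(Φ)(x) = ∑' φ, Φ(φ)·φ(x)`. -/
noncomputable def Wmu {X : Type*} (Φ : (X → ℝ≥0∞) → ℝ≥0∞) : X → ℝ≥0∞ :=
  fun x => ∑' φ : X → ℝ≥0∞, Φ φ * φ x

/-- A weighted De Simone rule for an `n`-ary operation `f`: disjoint action-premise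
positions `actPrem` (with labels `plab`) and termination-premise positions `termPrem`,
a weight, and a conclusion which is either a label with an affine target term over the
variables `y_i` (`Sum.inl i`, `i ∈ actPrem`) and `x_j` (`Sum.inr j`,
`j ∉ actPrem ∪ termPrem`), or termination `*`. -/
structure WRule (L Op : Type) (ar : Op → ℕ) (f : Op) where
  actPrem : Set (Fin (ar f))
  termPrem : Set (Fin (ar f))
  disj : ∀ i, i ∈ actPrem → i ∉ termPrem
  plab : Fin (ar f) → L
  weight : ℝ≥0∞
  concl : (L × FreeTerm Op ar (Fin (ar f) ⊕ Fin (ar f))) ⊕ Unit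
  wf_y : ∀ a t, concl = Sum.inl (a, t) → ∀ i, 0 < occ t (Sum.inl i) → i ∈ actPrem
  wf_x : ∀ a t, concl = Sum.inl (a, t) → ∀ j, 0 < occ t (Sum.inr j) →
    j ∉ actPrem ∧ j ∉ termPrem
  affine : ∀ a t, concl = Sum.inl (a, t) → ∀ v, occ t v ≤ 1

open Classical in
/-- The operational model `γ` of a set `R` of weighted De Simone rules. -/
noncomputable def gamma {L Op : Type} {ar : Op → ℕ}
    (R : ∀ f : Op, Set (WRule L Op ar f)) :
    Tm Op ar → ((L × Tm Op ar) ⊕ Unit) → ℝ≥0∞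
  | .op f ts => fun w =>
    ∑' r : {r : WRule L Op ar f // r ∈ R f},
      ∑' ss : {i : Fin (ar f) // i ∈ r.1.actPrem} → Tm Op ar,
        r.1.weight
        * (∏ i : Fin (ar f), if h : i ∈ r.1.actPrem
            then gamma R (ts i) (Sum.inl (r.1.plab i, ss ⟨i, h⟩)) else 1)
        * (∏ j : Fin (ar f), if j ∈ r.1.termPrem then gamma R (ts j) (Sum.inr ()) else 1)
        * (match r.1.concl with
          | Sum.inl (a, t) =>
              dirac (Sum.inl (a, substC
                (fun v => match v with
                  | Sum.inl i => if h : i ∈ r.1.actPrem then ss ⟨i, h⟩ else ts i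
                  | Sum.inr j => ts j) t)) w
          | Sum.inr _ => dirac (Sum.inr ()) w)

/-- A rule matches an argument tuple `u` if its action-premise positions are exactly the
action positions of `u` (with agreeing labels) and its termination-premise positions are
exactly the termination positions of `u`. -/
def Matches {L Op : Type} {ar : Op → ℕ} {X : Type} {f : Op} (r : WRule L Op ar f)
    (u : Fin (ar f) → (X ⊕ (L × X) ⊕ Unit)) : Prop :=
  (∀ i, i ∈ r.actPrem ↔ ∃ p, u i = Sum.inr (Sum.inl p)) ∧
  (∀ i a v, u i = Sum.inr (Sum.inl (a, v)) → r.plab i = a) ∧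
  (∀ j, j ∈ r.termPrem ↔ u j = Sum.inr (Sum.inr ()))

open Classical in
/-- The law `ρ_X : Σ(X ⊕ (L × X) ⊕ Unit) → W((L × Σ*X) ⊕ Unit)` induced by a set `R` of
weighted De Simone rules. -/
noncomputable def rhoW {L Op : Type} {ar : Op → ℕ}
    (R : ∀ f : Op, Set (WRule L Op ar f)) (X : Type)
    (e : (f : Op) × (Fin (ar f) → (X ⊕ (L × X) ⊕ Unit)))
    (w : (L × FreeTerm Op ar X) ⊕ Unit) : ℝ≥0∞ :=
  ∑' r : {r : WRule L Op ar e.1 // r ∈ R e.1 ∧ Matches r e.2},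
    r.1.weight *
      (if (∃ a t t', r.1.concl = Sum.inl (a, t) ∧ SubstRel e.2 t t' ∧
            w = Sum.inl (a, t')) ∨
          (r.1.concl = Sum.inr () ∧ w = Sum.inr ()) then 1 else 0)

/-- The distributive law `δ^Σ_Y : Σ(WY) → W(ΣY)`. -/
noncomputable def dSigmaW {Op : Type} {ar : Op → ℕ} (Y : Type)
    (e : (f : Op) × (Fin (ar f) → (Y → ℝ≥0∞))) :
    ((f : Op) × (Fin (ar f) → Y)) → ℝ≥0∞ :=
  fun w => ∑' x : Fin (ar e.1) → Y,
    (∏ i, e.2 i (x i)) * dirac (⟨e.1, x⟩ : (f : Op) × (Fin (ar f) → Y)) w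

/-- The distributive law `δ^{Σ*}_X : Σ*(WX) → W(Σ*X)`. -/
noncomputable def dSsW {Op : Type} {ar : Op → ℕ} {X : Type} :
    FreeTerm Op ar (X → ℝ≥0∞) → FreeTerm Op ar X → ℝ≥0∞
  | .var φ => fun w => ∑' x : X, φ x * dirac (FreeTerm.var x) w
  | .op f u => fun w => ∑' ws : Fin (ar f) → FreeTerm Op ar X,
      (∏ i, dSsW (u i) (ws i)) * dirac (FreeTerm.op f ws) w

/-- The distributive law `δ^B_X : (L × WX) ⊕ Unit → W((L × X) ⊕ Unit)`. -/
noncomputable def dBW {L X : Type} :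
    (L × (X → ℝ≥0∞)) ⊕ Unit → ((L × X) ⊕ Unit) → ℝ≥0∞
  | Sum.inl (a, φ) => fun w => ∑' x : X, φ x * dirac (Sum.inl (a, x)) w
  | Sum.inr _ => dirac (Sum.inr ())

/-- The distributive law `δ^{B₀}_X : WX ⊕ (L × WX) ⊕ Unit → W(X ⊕ (L × X) ⊕ Unit)`. -/
noncomputable def dB0W {L X : Type} :
    (X → ℝ≥0∞) ⊕ (L × (X → ℝ≥0∞)) ⊕ Unit → (X ⊕ (L × X) ⊕ Unit) → ℝ≥0∞
  | Sum.inl φ => fun w => ∑' x : X, φ x * dirac (Sum.inl x) w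
  | Sum.inr (Sum.inl (a, φ)) => fun w => ∑' x : X, φ x * dirac (Sum.inr (Sum.inl (a, x))) w
  | Sum.inr (Sum.inr _) => dirac (Sum.inr (Sum.inr ()))

/-- The map `(id_L × δ^{Σ*}_X) ⊕ id`. -/
noncomputable def midMapW {L Op : Type} {ar : Op → ℕ} {X : Type} :
    (L × FreeTerm Op ar (X → ℝ≥0∞)) ⊕ Unit →
      (L × (FreeTerm Op ar X → ℝ≥0∞)) ⊕ Unit
  | Sum.inl (a, t) => Sum.inl (a, dSsW t)
  | Sum.inr u => Sum.inr u

/-- The weight of an `F`-weighted sum over tuples with independent coordinate weights `p`. -/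
noncomputable def piExp {n : ℕ} {Y : Type*} (p : Fin n → Y → ℝ≥0∞)
    (F : (Fin n → Y) → ℝ≥0∞) : ℝ≥0∞ :=
  ∑' x : Fin n → Y, (∏ i, p i (x i)) * F x

theorem tsum_prod_pi {n : ℕ} {Y : Type*} (p : Fin n → Y → ℝ≥0∞) :
    ∑' x : Fin n → Y, ∏ i, p i (x i) = ∏ i, ∑' y, p i y := by
  induction n with
  | zero => simp
  | succ n ih =>
    rw [← (Fin.consEquiv (fun _ : Fin (n + 1) => Y)).tsum_eq, ENNReal.tsum_prod',
      Fin.prod_univ_succ, ← ih, ← ENNReal.tsum_mul_right]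
    refine tsum_congr fun y => ?_
    rw [← ENNReal.tsum_mul_left]
    exact tsum_congr fun x => by simp [Fin.consEquiv, Fin.prod_univ_succ]

section piExp

variable {n : ℕ} {Y : Type*} {p : Fin n → Y → ℝ≥0∞}

theorem piExp_one (hp : ∀ i, ∑' y, p i y = 1) : piExp p (fun _ => 1) = 1 := by
  simp [piExp, tsum_prod_pi, hp]

theorem piExp_zero : piExp p (fun _ => 0) = 0 := by
  simp [piExp]

theorem piExp_coord (hp : ∀ i, ∑' y, p i y = 1) (i : Fin n) (h : Y → ℝ≥0∞) :
    piExp p (fun x => h (x i)) = ∑' y, p i y * h y := by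
  have key : ∀ x : Fin n → Y, (∏ j, p j (x j)) * h (x i) =
      ∏ j, p j (x j) * (if j = i then h (x j) else 1) := fun x => by
    rw [Finset.prod_mul_distrib, Finset.prod_ite_eq' Finset.univ i (fun j => h (x j))]
    simp
  simp only [piExp, key]
  rw [tsum_prod_pi (fun j y => p j y * (if j = i then h y else 1)),
    Finset.prod_eq_single i (fun j _ hj => by simp [hj, hp]) (by simp)]
  simp

open Classical in
theorem piExp_mul (hp : ∀ i, ∑' y, p i y = 1) {S T : Set (Fin n)} (hST : Disjoint S T)
    {F G : (Fin n → Y) → ℝ≥0∞} (hF : DependsOn F S) (hG : DependsOn G T) :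
    piExp p (fun x => F x * G x) = piExp p F * piExp p G := by
  have hinv : Function.Involutive (fun z : (Fin n → Y) × (Fin n → Y) =>
      (S.piecewise z.1 z.2, S.piecewise z.2 z.1)) := fun z => by
    ext i <;> by_cases hi : i ∈ S <;> simp [hi]
  have hprod : ∀ z : (Fin n → Y) × (Fin n → Y),
      (∏ i, p i (S.piecewise z.1 z.2 i)) * (∏ i, p i (S.piecewise z.2 z.1 i)) =
        (∏ i, p i (z.1 i)) * ∏ i, p i (z.2 i) := fun z => by
    rw [← Finset.prod_mul_distrib, ← Finset.prod_mul_distrib]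
    refine Finset.prod_congr rfl fun i _ => ?_
    by_cases hi : i ∈ S <;> simp [hi, mul_comm]
  have h1 : piExp p F * piExp p G =
      ∑' z : (Fin n → Y) × (Fin n → Y),
        ((∏ i, p i (z.1 i)) * ∏ i, p i (z.2 i)) * (F z.1 * G z.2) := by
    rw [ENNReal.tsum_prod']
    simp only [piExp]
    rw [← ENNReal.tsum_mul_right]
    refine tsum_congr fun x => ?_
    rw [← ENNReal.tsum_mul_left]
    exact tsum_congr fun y => by ring
  rw [h1, ← hinv.toPerm.tsum_eq, ENNReal.tsum_prod']
  simp only [Function.Involutive.coe_toPerm, piExp]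
  refine tsum_congr fun x => ?_
  have h2 : ∀ y : Fin n → Y,
      ((∏ i, p i (S.piecewise x y i)) * ∏ i, p i (S.piecewise y x i)) *
        (F (S.piecewise x y) * G (S.piecewise y x)) =
      ((∏ i, p i (x i)) * (F x * G x)) * ∏ i, p i (y i) := fun y => by
    rw [hprod (x, y), hF (y := x) fun i hi => by simp [hi],
      hG (y := x) fun i hi => by
        simp [Set.disjoint_right.1 hST hi]]
    ring
  simp only [h2]
  rw [ENNReal.tsum_mul_left, tsum_prod_pi]
  simp [hp]

theorem piExp_prod (hp : ∀ i, ∑' y, p i y = 1) {ι : Type*} (s : Finset ι)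
    {S : ι → Set (Fin n)} (hS : Pairwise fun k l => Disjoint (S k) (S l))
    {F : ι → (Fin n → Y) → ℝ≥0∞} (hF : ∀ k, DependsOn (F k) (S k)) :
    piExp p (fun x => ∏ k ∈ s, F k x) = ∏ k ∈ s, piExp p (F k) := by
  classical
  induction s using Finset.induction_on with
  | empty => simpa using piExp_one hp
  | insert k s hk ih =>
    simp only [Finset.prod_insert hk, ← ih]
    refine piExp_mul hp (T := ⋃ l ∈ s, S l) ?_ (hF k) ?_
    · simp only [Set.disjoint_iUnion_right]
      exact fun l hl => hS fun h => hk (h ▸ hl)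
    · exact fun x y h => Finset.prod_congr rfl fun l hl =>
        hF l fun i hi => h i (Set.mem_biUnion hl hi)

end piExp

theorem tsum_Wmap_mul {X Y : Type*} (h : X → Y) (φ : X → ℝ≥0∞) (g : Y → ℝ≥0∞) :
    ∑' y, Wmap h φ y * g y = ∑' x, φ x * g (h x) := by
  rw [← ENNReal.tsum_fiberwise (fun x => φ x * g (h x)) h]
  refine tsum_congr fun y => ?_
  rw [Wmap, ← ENNReal.tsum_mul_right]
  exact tsum_congr fun x => by rw [show h x.1 = y from x.2]

theorem tsum_mul_dirac {X Y : Type*} {c : X → Y} (hc : Function.Injective c)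
    (φ : X → ℝ≥0∞) (s : X) : ∑' x, φ x * dirac (c x) (c s) = φ s := by
  rw [tsum_eq_single s fun x hx => by simp [dirac, hc.eq_iff, hx.symm]]
  simp [dirac]

theorem tsum_mul_dirac_of_notMem {X Y : Type*} {c : X → Y} {w : Y}
    (hw : ∀ x, w ≠ c x) (φ : X → ℝ≥0∞) : ∑' x, φ x * dirac (c x) w = 0 := by
  simp [dirac, hw]

theorem tsum_tsum_mul_dirac_mul {X Y : Type*} (c : X → Y) (φ : X → ℝ≥0∞) (g : Y → ℝ≥0∞) :
    ∑' y, (∑' x, φ x * dirac (c x) y) * g y = ∑' x, φ x * g (c x) := by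
  simp only [← ENNReal.tsum_mul_right]
  rw [ENNReal.tsum_comm]
  refine tsum_congr fun x => ?_
  rw [tsum_eq_single (c x) fun y hy => by simp [dirac, hy]]
  simp [dirac]

section law

variable {L Op : Type} {ar : Op → ℕ} {X : Type} {n : ℕ}

theorem substRel_congr {u v : Fin n → X ⊕ (L × X) ⊕ Unit}
    {t : FreeTerm Op ar (Fin n ⊕ Fin n)} {t' : FreeTerm Op ar X}
    (huv : ∀ i, 0 < occ t (Sum.inl i) ∨ 0 < occ t (Sum.inr i) → u i = v i)
    (h : SubstRel u t t') : SubstRel v t t' := by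
  induction h with
  | y hi => exact .y ((huv _ (by simp [occ])).symm.trans hi)
  | x hj => exact .x ((huv _ (by simp [occ])).symm.trans hj)
  | op _ ih =>
    refine .op fun k => ih k fun i hi => huv i ?_
    simp only [occ, Finset.sum_pos_iff]
    exact hi.imp (fun h => ⟨k, Finset.mem_univ k, h⟩) (fun h => ⟨k, Finset.mem_univ k, h⟩)

theorem SubstRel.unique {u : Fin n → X ⊕ (L × X) ⊕ Unit}
    {t : FreeTerm Op ar (Fin n ⊕ Fin n)} {s s' : FreeTerm Op ar X}
    (h : SubstRel u t s) (h' : SubstRel u t s') : s = s' := by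
  induction h generalizing s' with
  | y hi => cases h' with | y hi' => simp_all
  | x hj => cases h' with | x hj' => simp_all
  | op _ ih => cases h' with | op hk => exact congrArg _ (funext fun k => ih k (hk k))

theorem exists_substRel {u : Fin n → X ⊕ (L × X) ⊕ Unit}
    (t : FreeTerm Op ar (Fin n ⊕ Fin n))
    (hy : ∀ i, 0 < occ t (Sum.inl i) → ∃ p, u i = Sum.inr (Sum.inl p))
    (hx : ∀ i, 0 < occ t (Sum.inr i) → ∃ x, u i = Sum.inl x) :
    ∃ t', SubstRel u t t' := by
  induction t with
  | var v =>
    rcases v with i | i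
    · obtain ⟨⟨a, v⟩, h⟩ := hy i (by simp [occ])
      exact ⟨_, .y h⟩
    · obtain ⟨x, h⟩ := hx i (by simp [occ])
      exact ⟨_, .x h⟩
  | op g ts ih =>
    choose ws hws using fun k => ih k
      (fun i hi => hy i (Finset.sum_pos_iff.2 ⟨k, Finset.mem_univ k, hi⟩))
      (fun i hi => hx i (Finset.sum_pos_iff.2 ⟨k, Finset.mem_univ k, hi⟩))
    exact ⟨_, .op hws⟩

theorem tsum_dB0W {V : (X → ℝ≥0∞) ⊕ (L × (X → ℝ≥0∞)) ⊕ Unit}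
    (hV : (∀ φ, V = Sum.inl φ → (∑' x : X, φ x) = 1) ∧
      (∀ a φ, V = Sum.inr (Sum.inl (a, φ)) → (∑' x : X, φ x) = 1)) :
    ∑' y, dB0W V y = 1 := by
  rcases V with φ | ⟨a, φ⟩ | _
  · simpa [dB0W, hV.1 φ rfl] using tsum_tsum_mul_dirac_mul
      (fun x => (Sum.inl x : X ⊕ (L × X) ⊕ Unit)) φ (fun _ => 1)
  · simpa [dB0W, hV.2 a φ rfl] using tsum_tsum_mul_dirac_mul
      (fun x => (Sum.inr (Sum.inl (a, x)) : X ⊕ (L × X) ⊕ Unit)) φ (fun _ => 1)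
  · simp [dB0W, dirac]

open Classical in
/-- On affine terms, the distributive law `δ^{Σ*}` is the distribution of the term obtained by
substituting independently drawn arguments. -/
theorem dSsW_eq_piExp {U : Fin n → (X → ℝ≥0∞) ⊕ (L × (X → ℝ≥0∞)) ⊕ Unit}
    (hp : ∀ i, ∑' y, dB0W (U i) y = 1)
    {t : FreeTerm Op ar (Fin n ⊕ Fin n)} {t' : FreeTerm Op ar (X → ℝ≥0∞)}
    (h : SubstRel U t t') (ht : ∀ i, occ t (Sum.inl i) + occ t (Sum.inr i) ≤ 1)
    (s : FreeTerm Op ar X) :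
    dSsW t' s = piExp (fun i => dB0W (U i)) (fun x => if SubstRel x t s then 1 else 0) := by
  induction h generalizing s with
  | @y i a φ hi =>
    have h1 : ∀ x : Fin n → X ⊕ (L × X) ⊕ Unit, SubstRel x (.var (Sum.inl i)) s ↔
        ∃ a v, x i = Sum.inr (Sum.inl (a, v)) ∧ s = FreeTerm.var v := fun x =>
      ⟨fun h => by cases h with | y h => exact ⟨_, _, h, rfl⟩,
        fun ⟨a, v, h, hs⟩ => hs ▸ .y h⟩
    simp only [h1]
    rw [piExp_coord hp i (fun y => if ∃ a v, y = Sum.inr (Sum.inl (a, v)) ∧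
      s = FreeTerm.var v then 1 else 0), hi]
    simp only [dB0W, dSsW]
    rw [tsum_tsum_mul_dirac_mul (fun x => (Sum.inr (Sum.inl (a, x)) : X ⊕ (L × X) ⊕ Unit))]
    refine tsum_congr fun x => ?_
    simp [dirac]
  | @x j φ hj =>
    have h1 : ∀ x : Fin n → X ⊕ (L × X) ⊕ Unit, SubstRel x (.var (Sum.inr j)) s ↔
        ∃ v, x j = Sum.inl v ∧ s = FreeTerm.var v := fun x =>
      ⟨fun h => by cases h with | x h => exact ⟨_, h, rfl⟩,
        fun ⟨v, h, hs⟩ => hs ▸ .x h⟩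
    simp only [h1]
    rw [piExp_coord hp j (fun y => if ∃ v, y = Sum.inl v ∧
      s = FreeTerm.var v then 1 else 0), hj]
    simp only [dB0W, dSsW]
    rw [tsum_tsum_mul_dirac_mul (fun x => (Sum.inl x : X ⊕ (L × X) ⊕ Unit))]
    refine tsum_congr fun x => ?_
    simp [dirac]
  | @op g ts us hts ih =>
    have hle : ∀ k v, occ (ts k) v ≤ occ (FreeTerm.op g ts) v := fun k v =>
      Finset.single_le_sum (f := fun k => occ (ts k) v) (fun _ _ => Nat.zero_le _)
        (Finset.mem_univ k)
    have hle2 : ∀ k l v, k ≠ l → occ (ts k) v + occ (ts l) v ≤ occ (FreeTerm.op g ts) v :=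
      fun k l v hkl => by
        rw [← Finset.sum_pair (f := fun k => occ (ts k) v) hkl]
        exact Finset.sum_le_sum_of_subset (Finset.subset_univ _)
    by_cases hs : ∃ ws, s = FreeTerm.op g ws
    · obtain ⟨ws, rfl⟩ := hs
      have h1 : ∀ x : Fin n → X ⊕ (L × X) ⊕ Unit,
          SubstRel x (.op g ts) (.op g ws) ↔ ∀ k, SubstRel x (ts k) (ws k) := fun x =>
        ⟨fun h => by cases h with | op h => exact h, .op⟩
      have h2 : ∀ x : Fin n → X ⊕ (L × X) ⊕ Unit,
          (if SubstRel x (.op g ts) (.op g ws) then (1 : ℝ≥0∞) else 0) =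
            ∏ k, if SubstRel x (ts k) (ws k) then 1 else 0 := fun x => by
        simp [h1, Finset.prod_ite_zero]
      simp only [h2]
      rw [piExp_prod hp _
        (S := fun k => {i | 0 < occ (ts k) (Sum.inl i) ∨ 0 < occ (ts k) (Sum.inr i)})]
      · simp only [dSsW]
        rw [tsum_mul_dirac (c := FreeTerm.op g)
          (fun _ _ h => by simpa using h) (fun ws => ∏ i, dSsW (us i) (ws i))]
        refine Finset.prod_congr rfl fun k _ => ih k (fun i => ?_) _
        exact (add_le_add (hle k _) (hle k _)).trans (ht i)
      · intro k l hkl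
        refine Set.disjoint_left.2 fun i hk hl => ?_
        have := ht i
        have := hle2 k l (Sum.inl i) hkl
        have := hle2 k l (Sum.inr i) hkl
        simp only [Set.mem_ofPred_eq] at hk hl
        omega
      · intro k x y hxy
        have : SubstRel x (ts k) (ws k) ↔ SubstRel y (ts k) (ws k) :=
          ⟨substRel_congr hxy, substRel_congr fun i hi => (hxy i hi).symm⟩
        simp only [this]
    · have h1 : ∀ x : Fin n → X ⊕ (L × X) ⊕ Unit, ¬ SubstRel x (.op g ts) s := fun x h => by
        cases h with | op h => exact hs ⟨_, rfl⟩
      simp only [h1, if_false, piExp_zero, dSsW]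
      exact tsum_mul_dirac_of_notMem (c := FreeTerm.op g) (fun ws h => hs ⟨ws, h⟩) _

/-- Arguments with positive weight have the same shape as the weighted arguments. -/
theorem matches_iff_of_ne_zero {f : Op} (r : WRule L Op ar f)
    {U : Fin (ar f) → (X → ℝ≥0∞) ⊕ (L × (X → ℝ≥0∞)) ⊕ Unit}
    {x : Fin (ar f) → X ⊕ (L × X) ⊕ Unit} (hx : ∀ i, dB0W (U i) (x i) ≠ 0) :
    Matches r x ↔ Matches r U := by
  have shape : ∀ i, (∃ φ v, U i = Sum.inl φ ∧ x i = Sum.inl v) ∨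
      (∃ a φ v, U i = Sum.inr (Sum.inl (a, φ)) ∧ x i = Sum.inr (Sum.inl (a, v))) ∨
      (U i = Sum.inr (Sum.inr ()) ∧ x i = Sum.inr (Sum.inr ())) := fun i => by
    have h := hx i
    rcases hU : U i with φ | ⟨a, φ⟩ | _ <;> rw [hU] at h <;> simp only [dB0W] at h
    · refine Or.inl ⟨φ, ?_⟩
      by_contra! hne
      exact h (tsum_mul_dirac_of_notMem (fun v => hne v rfl) _)
    · refine Or.inr (Or.inl ⟨a, φ, ?_⟩)
      by_contra! hne
      exact h (tsum_mul_dirac_of_notMem (c := fun v => Sum.inr (Sum.inl (a, v)))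
        (fun v => hne v rfl) _)
    · refine Or.inr (Or.inr ⟨rfl, ?_⟩)
      by_contra hne
      exact h (by simp [dirac, hne])
  have h1 : ∀ i, (∃ p, x i = Sum.inr (Sum.inl p)) ↔ ∃ p, U i = Sum.inr (Sum.inl p) := fun i => by
    rcases shape i with ⟨φ, v, h, h'⟩ | ⟨a, φ, v, h, h'⟩ | ⟨h, h'⟩ <;> simp [h, h']
  have h2 : ∀ i, (∀ a v, x i = Sum.inr (Sum.inl (a, v)) → r.plab i = a) ↔
      ∀ a v, U i = Sum.inr (Sum.inl (a, v)) → r.plab i = a := fun i => by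
    rcases shape i with ⟨φ, v, h, h'⟩ | ⟨a, φ, v, h, h'⟩ | ⟨h, h'⟩ <;> simp [h, h']
  have h3 : ∀ i, x i = Sum.inr (Sum.inr ()) ↔ U i = Sum.inr (Sum.inr ()) := fun i => by
    rcases shape i with ⟨φ, v, h, h'⟩ | ⟨a, φ, v, h, h'⟩ | ⟨h, h'⟩ <;> simp [h, h']
  simp only [Matches, h1, h2, h3]

/-- The rule `r` with arguments `u` concludes `w`. -/
def Concludes {f : Op} (r : WRule L Op ar f) (u : Fin (ar f) → X ⊕ (L × X) ⊕ Unit)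
    (w : (L × FreeTerm Op ar X) ⊕ Unit) : Prop :=
  (∃ a t t', r.concl = Sum.inl (a, t) ∧ SubstRel u t t' ∧ w = Sum.inl (a, t')) ∨
    (r.concl = Sum.inr () ∧ w = Sum.inr ())

open Classical in
theorem rhoW_eq (R : ∀ f : Op, Set (WRule L Op ar f)) (f : Op)
    (u : Fin (ar f) → X ⊕ (L × X) ⊕ Unit) (w : (L × FreeTerm Op ar X) ⊕ Unit) :
    rhoW R X ⟨f, u⟩ w = ∑' r : R f, if Matches r.1 u then
      r.1.weight * (if Concludes r.1 u w then 1 else 0) else 0 := by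
  have h1 := tsum_subtype {r | r ∈ R f ∧ Matches r u}
    (fun r => r.weight * (if Concludes r u w then (1 : ℝ≥0∞) else 0))
  have h2 := tsum_subtype (R f) (fun r => if Matches r u then
      r.weight * (if Concludes r u w then (1 : ℝ≥0∞) else 0) else 0)
  have h0 : rhoW R X ⟨f, u⟩ w = ∑' r : {r | r ∈ R f ∧ Matches r u},
      r.1.weight * (if Concludes r.1 u w then 1 else 0) :=
    tsum_congr fun r => congrArg _ (if_congr Iff.rfl rfl rfl)
  rw [h0]
  refine h1.trans (Eq.trans (tsum_congr fun r => ?_) h2.symm)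
  by_cases hr : r ∈ R f <;> by_cases hm : Matches r u <;> simp [Set.indicator, hr, hm]

open Classical in
theorem tsum_concludes_eq_piExp {f : Op} (r : WRule L Op ar f)
    {U : Fin (ar f) → (X → ℝ≥0∞) ⊕ (L × (X → ℝ≥0∞)) ⊕ Unit}
    (hp : ∀ i, ∑' y, dB0W (U i) y = 1) (hm : Matches r U)
    (w : (L × FreeTerm Op ar X) ⊕ Unit) :
    ∑' v, (if Concludes r U v then 1 else 0) * dBW (midMapW v) w =
      piExp (fun i => dB0W (U i)) (fun x => if Concludes r x w then 1 else 0) := by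
  rcases hc : r.concl with ⟨a, t⟩ | _
  · obtain ⟨t', ht'⟩ : ∃ t', SubstRel U t t' := by
      refine exists_substRel t (fun i hi => (hm.1 i).1 (r.wf_y a t hc i hi)) fun i hi => ?_
      have h := r.wf_x a t hc i hi
      rw [hm.1, hm.2.2] at h
      rcases hU : U i with φ | p | _
      · exact ⟨φ, rfl⟩
      · exact absurd ⟨p, hU⟩ h.1
      · exact absurd hU h.2
    have hv : ∀ v, Concludes r U v ↔ v = Sum.inl (a, t') := fun v => by
      simp only [Concludes, hc, Sum.inl.injEq, Prod.mk.injEq, reduceCtorEq, false_and, or_false]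
      constructor
      · rintro ⟨_, _, s, ⟨rfl, rfl⟩, hs, rfl⟩
        rw [hs.unique ht']
      · rintro rfl
        exact ⟨a, t, t', ⟨rfl, rfl⟩, ht', rfl⟩
    have hocc : ∀ i, occ t (Sum.inl i) + occ t (Sum.inr i) ≤ 1 := fun i => by
      have h1 := r.affine a t hc (Sum.inl i)
      have h2 := r.affine a t hc (Sum.inr i)
      by_contra hlt
      exact (r.wf_x a t hc i (by omega)).1 (r.wf_y a t hc i (by omega))
    rw [tsum_eq_single (Sum.inl (a, t')) fun v hne => by simp [hv, hne]]
    simp only [hv, if_true, one_mul, midMapW, dBW]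
    by_cases hw : ∃ s, w = Sum.inl (a, s)
    · obtain ⟨s, rfl⟩ := hw
      rw [tsum_mul_dirac (c := fun x => (Sum.inl (a, x) : (L × FreeTerm Op ar X) ⊕ Unit))
        (fun _ _ h => by simpa using h), dSsW_eq_piExp hp ht' hocc]
      congr 1
      funext x
      have : Concludes r x (Sum.inl (a, s)) ↔ SubstRel x t s := by
        simp only [Concludes, hc, Sum.inl.injEq, Prod.mk.injEq, reduceCtorEq, false_and, or_false]
        constructor
        · rintro ⟨_, _, _, ⟨rfl, rfl⟩, hs, _, rfl⟩
          exact hs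
        · exact fun h => ⟨a, t, s, ⟨rfl, rfl⟩, h, rfl, rfl⟩
      simp only [this]
    · have : ∀ x, ¬ Concludes r x w := fun x => by
        rintro (⟨b, t₀, s, h, _, rfl⟩ | ⟨h, _⟩)
        · rw [hc] at h
          cases h
          exact hw ⟨s, rfl⟩
        · simp [hc] at h
      simp only [this, if_false, piExp_zero]
      exact tsum_mul_dirac_of_notMem
        (c := fun x => (Sum.inl (a, x) : (L × FreeTerm Op ar X) ⊕ Unit))
        (fun s h => hw ⟨s, h⟩) _
  · have hw : ∀ (Z : Type) (u : Fin (ar f) → Z ⊕ (L × Z) ⊕ Unit) v,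
        Concludes r u v ↔ v = Sum.inr () := fun Z u v => by simp [Concludes, hc]
    simp only [hw]
    rw [tsum_eq_single (Sum.inr ()) fun v hne => by simp [hne]]
    by_cases h : w = Sum.inr ()
    · simp [h, midMapW, dBW, dirac, piExp_one hp]
    · simp [h, midMapW, dBW, dirac, piExp_zero]

end law

/-- **Weighted De Simone rules of probabilistic specifications induce De Simone laws.**
If the operational model of a set `R` of weighted De Simone rules is probabilistic, then
the induced law `ρ` is natural w.r.t. distribution-valued arguments: for every element
`f(U_1,…,U_n)` of `Σ(DX ⊕ (L × DX) ⊕ Unit)` the two legs of the naturality square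
agree. -/
theorem stmt16 {L Op : Type} {ar : Op → ℕ}
    (R : ∀ f : Op, Set (WRule L Op ar f))
    (hprob : ∀ t : Tm Op ar, (∑' u : (L × Tm Op ar) ⊕ Unit, gamma R t u) = 1)
    (X : Type) (f : Op)
    (U : Fin (ar f) → ((X → ℝ≥0∞) ⊕ (L × (X → ℝ≥0∞)) ⊕ Unit))
    (hU : ∀ i, (∀ φ, U i = Sum.inl φ → (∑' x : X, φ x) = 1) ∧
      (∀ a φ, U i = Sum.inr (Sum.inl (a, φ)) → (∑' x : X, φ x) = 1)) :
    Wmu (Wmap dBW (Wmap midMapW (rhoW R (X → ℝ≥0∞) ⟨f, U⟩))) =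
      Wmu (Wmap (rhoW R X)
        (dSigmaW (X ⊕ (L × X) ⊕ Unit) ⟨f, fun i => dB0W (U i)⟩)) := by
  classical
  have hp : ∀ i, ∑' y, dB0W (U i) y = 1 := fun i => tsum_dB0W (hU i)
  funext w
  have hl : Wmu (Wmap dBW (Wmap midMapW (rhoW R (X → ℝ≥0∞) ⟨f, U⟩))) w =
      ∑' v, rhoW R (X → ℝ≥0∞) ⟨f, U⟩ v * dBW (midMapW v) w := by
    rw [Wmu, tsum_Wmap_mul dBW _ (fun φ => φ w), tsum_Wmap_mul midMapW _ (fun φ => dBW φ w)]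
  have hr : Wmu (Wmap (rhoW R X)
        (dSigmaW (X ⊕ (L × X) ⊕ Unit) ⟨f, fun i => dB0W (U i)⟩)) w =
      piExp (fun i => dB0W (U i)) (fun x => rhoW R X ⟨f, x⟩ w) := by
    rw [Wmu, tsum_Wmap_mul (rhoW R X) _ (fun φ => φ w)]
    exact tsum_tsum_mul_dirac_mul
      (fun x => (⟨f, x⟩ : (f : Op) × (Fin (ar f) → X ⊕ (L × X) ⊕ Unit))) _ _
  rw [hl, hr]
  simp only [rhoW_eq, piExp, ← ENNReal.tsum_mul_right, ← ENNReal.tsum_mul_left]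
  rw [ENNReal.tsum_comm, ENNReal.tsum_comm (β := R f)]
  refine tsum_congr fun r => ?_
  by_cases hm : Matches r.1 U
  · have h1 : ∀ x : Fin (ar f) → X ⊕ (L × X) ⊕ Unit,
        (∏ i, dB0W (U i) (x i)) * (if Matches r.1 x then
          r.1.weight * (if Concludes r.1 x w then 1 else 0) else 0) =
        r.1.weight * ((∏ i, dB0W (U i) (x i)) * (if Concludes r.1 x w then 1 else 0)) :=
      fun x => by
        by_cases hx : ∀ i, dB0W (U i) (x i) ≠ 0
        · rw [if_pos ((matches_iff_of_ne_zero r.1 hx).2 hm)]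
          ring
        · push Not at hx
          obtain ⟨i, hi⟩ := hx
          simp [Finset.prod_eq_zero (f := fun i => dB0W (U i) (x i)) (Finset.mem_univ i) hi]
    simp only [h1, hm, if_true, mul_assoc, ENNReal.tsum_mul_left]
    exact congrArg _ (tsum_concludes_eq_piExp r.1 hp hm w)
  · have h1 : ∀ x : Fin (ar f) → X ⊕ (L × X) ⊕ Unit,
        (∏ i, dB0W (U i) (x i)) * (if Matches r.1 x then
          r.1.weight * (if Concludes r.1 x w then 1 else 0) else 0) = 0 := fun x => by
      by_cases hx : ∀ i, dB0W (U i) (x i) ≠ 0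
      · rw [if_neg (mt (matches_iff_of_ne_zero r.1 hx).1 hm), mul_zero]
      · push Not at hx
        obtain ⟨i, hi⟩ := hx
        simp [Finset.prod_eq_zero (f := fun i => dB0W (U i) (x i)) (Finset.mem_univ i) hi]
    simp only [h1, hm, if_false, zero_mul, tsum_zero]
end

section
/- Let R be a set of weighted De Simone rules that is probabilistic (for every closed term t, the total mass ∑ over u ∈ (L × Tm) ⊕ Unit of γ(t)(u) equals 1) and almost surely terminating (for every closed term t, ∑ over w ∈ List L of tr(t)(w) = 1). Then trace equivalence on the operational model is a congruence: for every operation symbol f of arity n and all closed terms t_1, …, t_n, s_1, …, s_n with tr(t_i) = tr(s_i) for i = 1, …, n, it holds that tr(f(t_1, …, t_n)) = tr(f(s_1, …, s_n)). -/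
open scoped ENNReal

/-- The trace map of the operational model:
`tr(t)(a_1⋯a_n) = ∑ over paths t = t_0 → t_1 → ⋯ → t_n of
(∏ γ(t_i)(a_{i+1}, t_{i+1})) · γ(t_n)(*)`. -/
noncomputable def wtr {L Op : Type} {ar : Op → ℕ}
    (R : ∀ f : Op, Set (WRule L Op ar f)) : Tm Op ar → List L → ℝ≥0∞
  | t, [] => gamma R t (Sum.inr ())
  | t, a :: w => ∑' t' : Tm Op ar, gamma R t (Sum.inl (a, t')) * wtr R t' w

section Substitution

variable {Op : Type} {ar : Op → ℕ} {V : Type} [DecidableEq V]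

theorem substC_congr {σ τ : V → Tm Op ar} (t : FreeTerm Op ar V)
    (h : ∀ v, 0 < occ t v → σ v = τ v) : substC σ t = substC τ t := by
  induction t with
  | var y => exact h y (by simp [occ])
  | op f u ih =>
    simp only [substC]
    congr 1
    funext i
    refine ih i fun v hv => h v ?_
    simp only [occ]
    exact hv.trans_le
      (Finset.single_le_sum (f := fun i => occ (u i) v) (fun _ _ => Nat.zero_le _)
        (Finset.mem_univ i))

/-- Functions on closed terms given by a context in which the hole occurs at most once. -/
inductive IsAffineCtx : (Tm Op ar → Tm Op ar) → Prop
  | hole : IsAffineCtx fun t => t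
  | const (s : Tm Op ar) : IsAffineCtx fun _ => s
  | op (f : Op) (i : Fin (ar f)) (ts : Fin (ar f) → Tm Op ar) {c : Tm Op ar → Tm Op ar} :
      IsAffineCtx c → IsAffineCtx fun t => .op f (Function.update ts i (c t))

theorem IsAffineCtx.substC_update {c : Tm Op ar → Tm Op ar} (hc : IsAffineCtx c)
    (σ : V → Tm Op ar) (v : V) (t : FreeTerm Op ar V) (ht : occ t v ≤ 1) :
    IsAffineCtx fun x => substC (Function.update σ v (c x)) t := by
  have fixed : ∀ (u : FreeTerm Op ar V) (x : Tm Op ar), occ u v = 0 →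
      substC (Function.update σ v (c x)) u = substC σ u := by
    intro u x hu
    refine substC_congr u fun w hw => Function.update_of_ne ?_ _ _
    rintro rfl
    omega
  induction t with
  | var y =>
    by_cases hy : y = v
    · subst hy
      simpa [substC] using hc
    · simpa [substC, hy] using IsAffineCtx.const (σ y)
  | op f u ih =>
    by_cases h0 : ∀ i, occ (u i) v = 0
    · have : occ (.op f u) v = 0 := by simp [occ, h0]
      simpa only [fixed _ _ this] using IsAffineCtx.const _
    · push Not at h0
      obtain ⟨i, hi⟩ := h0
      simp only [occ] at ht
      rw [← Finset.add_sum_erase _ _ (Finset.mem_univ i)] at ht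
      have hrest : ∑ j ∈ Finset.univ.erase i, occ (u j) v = 0 := by omega
      rw [Finset.sum_eq_zero_iff] at hrest
      have key := IsAffineCtx.op f i (fun j => substC σ (u j)) (ih i (by omega))
      convert key using 2 with x
      simp only [substC]
      congr 1
      funext j
      by_cases hj : j = i
      · subst hj
        simp
      · rw [Function.update_of_ne hj]
        exact fixed _ _ (hrest j (by simp [hj]))

end Substitution

section TraceInvariance

variable {L Op : Type} {ar : Op → ℕ} {R : ∀ f : Op, Set (WRule L Op ar f)}

/-- The integral of `G` against a weighting of closed terms depends only on the trace of that
weighting. -/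
def TraceInvariant (R : ∀ f : Op, Set (WRule L Op ar f)) (G : Tm Op ar → ℝ≥0∞) : Prop :=
  ∀ μ ν : Tm Op ar → ℝ≥0∞,
    (∀ w, ∑' t, μ t * wtr R t w = ∑' t, ν t * wtr R t w) →
      ∑' t, μ t * G t = ∑' t, ν t * G t

namespace TraceInvariant

theorem tsum {ι : Type*} {G : ι → Tm Op ar → ℝ≥0∞} (h : ∀ i, TraceInvariant R (G i)) :
    TraceInvariant R fun t => ∑' i, G i t := by
  intro μ ν hμν
  simp only [← ENNReal.tsum_mul_left]
  rw [ENNReal.tsum_comm, ENNReal.tsum_comm (f := fun t i => ν t * G i t)]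
  exact tsum_congr fun i => h i μ ν hμν

theorem add {G H : Tm Op ar → ℝ≥0∞} (hG : TraceInvariant R G) (hH : TraceInvariant R H) :
    TraceInvariant R fun t => G t + H t := by
  intro μ ν hμν
  simp only [mul_add, ENNReal.tsum_add, hG μ ν hμν, hH μ ν hμν]

theorem const_mul {G : Tm Op ar → ℝ≥0∞} (h : TraceInvariant R G) (c : ℝ≥0∞) :
    TraceInvariant R fun t => c * G t := by
  intro μ ν hμν
  simp only [mul_left_comm _ c, ENNReal.tsum_mul_left]
  rw [h μ ν hμν]

theorem trace (w : List L) : TraceInvariant R fun t => wtr R t w :=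
  fun _ _ h => h w

theorem const (hast : ∀ t : Tm Op ar, (∑' w : List L, wtr R t w) = 1) (c : ℝ≥0∞) :
    TraceInvariant R fun _ => c := by
  have := (tsum fun w => trace (R := R) w).const_mul c
  simpa only [hast, mul_one] using this

theorem action {g : Tm Op ar → ℝ≥0∞} (hg : TraceInvariant R g) (a : L) :
    TraceInvariant R fun t => ∑' s, gamma R t (Sum.inl (a, s)) * g s := by
  intro μ ν hμν
  have swap : ∀ (μ h : Tm Op ar → ℝ≥0∞),
      ∑' t, μ t * ∑' s, gamma R t (Sum.inl (a, s)) * h s =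
        ∑' s, (∑' t, μ t * gamma R t (Sum.inl (a, s))) * h s := by
    intro μ h
    simp only [← ENNReal.tsum_mul_left, ← ENNReal.tsum_mul_right]
    rw [ENNReal.tsum_comm]
    simp only [mul_assoc]
  rw [swap, swap]
  refine hg _ _ fun w => ?_
  rw [← swap, ← swap]
  exact hμν (a :: w)

end TraceInvariant

theorem tsum_dirac_mul {α : Type*} (x : α) (g : α → ℝ≥0∞) : ∑' w, dirac x w * g w = g x := by
  rw [tsum_eq_single x fun w hw => by simp [dirac, hw]]
  simp [dirac]

theorem tsum_mul_sumElim {α β γ : Type*} [DecidableEq α] [Unique γ] (F : (α × β) ⊕ γ → ℝ≥0∞) (a : α)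
    (G : β → ℝ≥0∞) :
    ∑' u, F u * Sum.elim (fun p => if p.1 = a then G p.2 else 0) (fun _ => 0) u =
      ∑' s, F (Sum.inl (a, s)) * G s := by
  rw [ENNReal.summable.tsum_sum ENNReal.summable, ENNReal.tsum_prod', tsum_eq_single a]
  · simp
  · intro b hb
    simp [hb]

theorem tsum_pi_eq_tsum_funSplitAt {ι β : Type*} [DecidableEq ι] (i : ι)
    (F : (ι → β) → ℝ≥0∞) :
    ∑' ss, F ss = ∑' ρ : {j // j ≠ i} → β, ∑' s, F ((Equiv.funSplitAt i β).symm (s, ρ)) := by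
  rw [← (Equiv.funSplitAt i β).symm.tsum_eq, ENNReal.tsum_prod', ENNReal.tsum_comm]

open Classical in
/-- The valuation of the variables of a rule determined by the arguments and the successors of
the action premises. -/
noncomputable def WRule.valuation {f : Op} (r : WRule L Op ar f) (ts : Fin (ar f) → Tm Op ar)
    (ss : {i : Fin (ar f) // i ∈ r.actPrem} → Tm Op ar) : Fin (ar f) ⊕ Fin (ar f) → Tm Op ar
  | Sum.inl i => if h : i ∈ r.actPrem then ss ⟨i, h⟩ else ts i
  | Sum.inr j => ts j

/-- The outcome of a rule whose variables are instantiated by `σ`. -/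
def WRule.outcome {f : Op} (r : WRule L Op ar f) (σ : Fin (ar f) ⊕ Fin (ar f) → Tm Op ar) :
    (L × Tm Op ar) ⊕ Unit :=
  match r.concl with
  | Sum.inl (a, t) => Sum.inl (a, substC σ t)
  | Sum.inr _ => Sum.inr ()

theorem WRule.outcome_congr {f : Op} (r : WRule L Op ar f)
    {σ τ : Fin (ar f) ⊕ Fin (ar f) → Tm Op ar}
    (hl : ∀ i ∈ r.actPrem, σ (Sum.inl i) = τ (Sum.inl i))
    (hr : ∀ j, j ∉ r.actPrem → j ∉ r.termPrem → σ (Sum.inr j) = τ (Sum.inr j)) :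
    r.outcome σ = r.outcome τ := by
  unfold WRule.outcome
  rcases hcon : r.concl with ⟨a, t⟩ | _
  · refine congrArg (fun s => Sum.inl (a, s)) (substC_congr t ?_)
    rintro (i | j) hv
    · exact hl i (r.wf_y a t hcon i hv)
    · obtain ⟨h₁, h₂⟩ := r.wf_x a t hcon j hv
      exact hr j h₁ h₂
  · rfl

open Classical in
theorem tsum_gamma_op_mul (f : Op) (ts : Fin (ar f) → Tm Op ar)
    (g : (L × Tm Op ar) ⊕ Unit → ℝ≥0∞) :
    ∑' u, gamma R (.op f ts) u * g u =
      ∑' r : {r : WRule L Op ar f // r ∈ R f},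
        ∑' ss : {i : Fin (ar f) // i ∈ r.1.actPrem} → Tm Op ar,
          r.1.weight
          * (∏ i : Fin (ar f), if h : i ∈ r.1.actPrem
              then gamma R (ts i) (Sum.inl (r.1.plab i, ss ⟨i, h⟩)) else 1)
          * (∏ j : Fin (ar f), if j ∈ r.1.termPrem then gamma R (ts j) (Sum.inr ()) else 1)
          * g (r.1.outcome (r.1.valuation ts ss)) := by
  have expand : ∀ u, gamma R (.op f ts) u =
      ∑' r : {r : WRule L Op ar f // r ∈ R f},
        ∑' ss : {i : Fin (ar f) // i ∈ r.1.actPrem} → Tm Op ar,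
          r.1.weight
          * (∏ i : Fin (ar f), if h : i ∈ r.1.actPrem
              then gamma R (ts i) (Sum.inl (r.1.plab i, ss ⟨i, h⟩)) else 1)
          * (∏ j : Fin (ar f), if j ∈ r.1.termPrem then gamma R (ts j) (Sum.inr ()) else 1)
          * dirac (r.1.outcome (r.1.valuation ts ss)) u := by
    intro u
    rw [gamma]
    refine tsum_congr fun r => tsum_congr fun ss => ?_
    congr 1
    unfold WRule.outcome
    rcases r.1.concl with ⟨a, t⟩ | _
    · have : r.1.valuation ts ss = fun v => match v with
          | Sum.inl i => if h : i ∈ r.1.actPrem then ss ⟨i, h⟩ else ts i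
          | Sum.inr j => ts j := by
        funext v
        cases v <;> rfl
      simp only [this]
    · rfl
  simp only [expand, ← ENNReal.tsum_mul_right]
  rw [ENNReal.tsum_comm]
  refine tsum_congr fun r => ?_
  rw [ENNReal.tsum_comm]
  refine tsum_congr fun ss => ?_
  simp only [mul_assoc, ENNReal.tsum_mul_left, tsum_dirac_mul]

theorem TraceInvariant.outcome_update
    (hast : ∀ t : Tm Op ar, (∑' w : List L, wtr R t w) = 1)
    {g : (L × Tm Op ar) ⊕ Unit → ℝ≥0∞}
    (hg : ∀ a c, IsAffineCtx c → TraceInvariant R fun t => g (Sum.inl (a, c t)))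
    {c : Tm Op ar → Tm Op ar} (hc : IsAffineCtx c) {f : Op} (r : WRule L Op ar f)
    (σ : Fin (ar f) ⊕ Fin (ar f) → Tm Op ar) (v : Fin (ar f) ⊕ Fin (ar f)) :
    TraceInvariant R fun x => g (r.outcome (Function.update σ v (c x))) := by
  unfold WRule.outcome
  rcases hcon : r.concl with ⟨a, t⟩ | _
  · exact hg a _ (hc.substC_update σ v t (r.affine a t hcon v))
  · exact TraceInvariant.const hast (g (Sum.inr ()))

/-- Integrating along one step from a context preserves trace invariance. -/
theorem IsAffineCtx.traceInvariant_tsum_gamma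
    (hast : ∀ t : Tm Op ar, (∑' w : List L, wtr R t w) = 1)
    {c : Tm Op ar → Tm Op ar} (hc : IsAffineCtx c)
    {g : (L × Tm Op ar) ⊕ Unit → ℝ≥0∞}
    (hg : ∀ a c, IsAffineCtx c → TraceInvariant R fun t => g (Sum.inl (a, c t))) :
    TraceInvariant R fun t => ∑' u, gamma R (c t) u * g u := by
  classical
  induction hc generalizing g with
  | hole =>
    simp only [ENNReal.summable.tsum_sum ENNReal.summable, ENNReal.tsum_prod', tsum_fintype,
      Finset.univ_unique, Finset.sum_singleton]
    refine (TraceInvariant.tsum fun a => TraceInvariant.action (hg a _ .hole) a).add ?_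
    simpa only [mul_comm, wtr] using (TraceInvariant.trace []).const_mul (g (Sum.inr ()))
  | const s => exact TraceInvariant.const hast _
  | op f i ts hc ih =>
    rename_i c
    simp only [tsum_gamma_op_mul]
    refine TraceInvariant.tsum fun ⟨r, _⟩ => ?_
    have termination_factor : ∀ x, (∏ j, if j ∈ r.termPrem then
        gamma R (Function.update ts i (c x) j) (Sum.inr ()) else 1) =
        (if i ∈ r.termPrem then gamma R (c x) (Sum.inr ()) else 1) *
          ∏ j ∈ Finset.univ.erase i, if j ∈ r.termPrem then
            gamma R (ts j) (Sum.inr ()) else 1 := by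
      intro x
      rw [← Finset.mul_prod_erase _ _ (Finset.mem_univ i), Function.update_self]
      congr 1
      refine Finset.prod_congr rfl fun j hj => ?_
      rw [Function.update_of_ne (Finset.ne_of_mem_erase hj)]
    have action_factor : ∀ x (ss : {i // i ∈ r.actPrem} → Tm Op ar),
        (∏ j, if h : j ∈ r.actPrem then
          gamma R (Function.update ts i (c x) j) (Sum.inl (r.plab j, ss ⟨j, h⟩)) else 1) =
        (if h : i ∈ r.actPrem then gamma R (c x) (Sum.inl (r.plab i, ss ⟨i, h⟩)) else 1) *
          ∏ j ∈ Finset.univ.erase i, if h : j ∈ r.actPrem then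
            gamma R (ts j) (Sum.inl (r.plab j, ss ⟨j, h⟩)) else 1 := by
      intro x ss
      rw [← Finset.mul_prod_erase _ _ (Finset.mem_univ i), Function.update_self]
      congr 1
      refine Finset.prod_congr rfl fun j hj => ?_
      rw [Function.update_of_ne (Finset.ne_of_mem_erase hj)]
    simp only [termination_factor, action_factor]
    by_cases hi : i ∈ r.actPrem
    · have hi' : i ∉ r.termPrem := r.disj i hi
      simp only [hi, hi', dite_true, if_false, one_mul]
      simp only [tsum_pi_eq_tsum_funSplitAt (⟨i, hi⟩ : {i // i ∈ r.actPrem})]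
      refine TraceInvariant.tsum fun ρ => ?_
      let τ : Tm Op ar → {i // i ∈ r.actPrem} → Tm Op ar := fun s =>
        (Equiv.funSplitAt (⟨i, hi⟩ : {i // i ∈ r.actPrem}) (Tm Op ar)).symm (s, ρ)
      have τ_self : ∀ s, τ s ⟨i, hi⟩ = s := fun s => by simp [τ, Equiv.funSplitAt]
      have τ_ne : ∀ s j (hj : j ∈ r.actPrem), j ≠ i → τ s ⟨j, hj⟩ = τ (ts i) ⟨j, hj⟩ :=
        fun s j hj hne => by simp [τ, Equiv.funSplitAt, hne]
      have hout : ∀ x s, r.outcome (r.valuation (Function.update ts i (c x)) (τ s)) =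
          r.outcome (Function.update (r.valuation ts (τ (ts i))) (Sum.inl i) s) := by
        intro x s
        refine r.outcome_congr (fun j hj => ?_) (fun j hj _ => ?_)
        · by_cases hji : j = i
          · subst hji
            simp [WRule.valuation, hj, τ_self]
          · simp [WRule.valuation, hj, hji, τ_ne s j hj hji]
        · have hji : j ≠ i := by
            rintro rfl
            exact hj hi
          simp [WRule.valuation, hji]
      have hprod : ∀ s, (∏ j ∈ Finset.univ.erase i, if h : j ∈ r.actPrem then
            gamma R (ts j) (Sum.inl (r.plab j, τ s ⟨j, h⟩)) else 1) =
          ∏ j ∈ Finset.univ.erase i, if h : j ∈ r.actPrem then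
            gamma R (ts j) (Sum.inl (r.plab j, τ (ts i) ⟨j, h⟩)) else 1 := by
        intro s
        refine Finset.prod_congr rfl fun j hj => ?_
        split_ifs with h
        · rw [τ_ne s j h (Finset.ne_of_mem_erase hj)]
        · rfl
      have hstep := ih (g := Sum.elim (fun p => if p.1 = r.plab i then
          g (r.outcome (Function.update (r.valuation ts (τ (ts i))) (Sum.inl i) p.2)) else 0)
          fun _ => 0) fun b c' hc' => by
        by_cases hb : b = r.plab i
        · simpa [hb] using TraceInvariant.outcome_update hast hg hc' r _ _
        · simpa [hb] using TraceInvariant.const hast 0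
      simp only [tsum_mul_sumElim _ (r.plab i) fun s =>
        g (r.outcome (Function.update (r.valuation ts (τ (ts i))) (Sum.inl i) s))] at hstep
      convert hstep.const_mul (r.weight
        * (∏ j ∈ Finset.univ.erase i, if h : j ∈ r.actPrem then
            gamma R (ts j) (Sum.inl (r.plab j, τ (ts i) ⟨j, h⟩)) else 1)
        * ∏ j ∈ Finset.univ.erase i, if j ∈ r.termPrem then
            gamma R (ts j) (Sum.inr ()) else 1) using 2 with x
      rw [← ENNReal.tsum_mul_left]
      refine tsum_congr fun s => ?_
      change r.weight * (gamma R (c x) (Sum.inl (r.plab i, τ s ⟨i, hi⟩)) *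
        ∏ j ∈ Finset.univ.erase i, if h : j ∈ r.actPrem then
            gamma R (ts j) (Sum.inl (r.plab j, τ s ⟨j, h⟩)) else 1) * _ *
          g (r.outcome (r.valuation (Function.update ts i (c x)) (τ s))) = _
      rw [hout, hprod, τ_self]
      ring
    · have hout : ∀ x ss, r.outcome (r.valuation (Function.update ts i (c x)) ss) =
          r.outcome (Function.update (r.valuation ts ss) (Sum.inr i) (c x)) := by
        intro x ss
        refine r.outcome_congr (fun j hj => ?_) (fun j _ _ => ?_)
        · simp [WRule.valuation, hj]
        · by_cases hji : j = i
          · subst hji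
            simp [WRule.valuation]
          · simp [WRule.valuation, hji]
      refine TraceInvariant.tsum fun ss => ?_
      simp only [hi, dite_false, one_mul]
      by_cases hi' : i ∈ r.termPrem
      · have hconst : ∀ x, r.outcome (r.valuation (Function.update ts i (c x)) ss) =
            r.outcome (r.valuation ts ss) := by
          intro x
          refine r.outcome_congr (fun j hj => ?_) (fun j _ hj => ?_)
          · simp [WRule.valuation, hj]
          · have hji : j ≠ i := by
              rintro rfl
              exact hj hi'
            simp [WRule.valuation, hji]
        have hterm : TraceInvariant R fun x => gamma R (c x) (Sum.inr ()) := by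
          have := ih (g := dirac (Sum.inr ())) fun a c _ => by
            simpa [dirac] using TraceInvariant.const hast 0
          simpa only [mul_comm (gamma R _ _), tsum_dirac_mul] using this
        simp only [hconst, hi', if_true]
        convert hterm.const_mul (r.weight
          * (∏ j ∈ Finset.univ.erase i, if h : j ∈ r.actPrem then
              gamma R (ts j) (Sum.inl (r.plab j, ss ⟨j, h⟩)) else 1)
          * (∏ j ∈ Finset.univ.erase i, if j ∈ r.termPrem then
              gamma R (ts j) (Sum.inr ()) else 1)
          * g (r.outcome (r.valuation ts ss))) using 2 with x
        ring
      · simp only [hi', if_false, hout]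
        exact (TraceInvariant.outcome_update hast hg hc r _ _).const_mul _

theorem IsAffineCtx.traceInvariant_wtr
    (hast : ∀ t : Tm Op ar, (∑' w : List L, wtr R t w) = 1) (w : List L)
    {c : Tm Op ar → Tm Op ar} (hc : IsAffineCtx c) :
    TraceInvariant R fun t => wtr R (c t) w := by
  classical
  induction w generalizing c with
  | nil =>
    have := hc.traceInvariant_tsum_gamma hast (g := dirac (Sum.inr ())) fun a c _ => by
      simpa [dirac] using TraceInvariant.const hast 0
    simpa only [mul_comm (gamma R _ _), tsum_dirac_mul, wtr] using this
  | cons a w ih =>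
    have := hc.traceInvariant_tsum_gamma hast
      (g := Sum.elim (fun p => if p.1 = a then wtr R p.2 w else 0) fun _ => 0) fun b c hc => by
        by_cases hb : b = a
        · simpa [hb] using ih hc
        · simpa [hb] using TraceInvariant.const hast 0
    simpa only [tsum_mul_sumElim _ a fun s => wtr R s w, wtr] using this

theorem IsAffineCtx.wtr_congr
    (hast : ∀ t : Tm Op ar, (∑' w : List L, wtr R t w) = 1)
    {c : Tm Op ar → Tm Op ar} (hc : IsAffineCtx c) {t s : Tm Op ar}
    (h : wtr R t = wtr R s) : wtr R (c t) = wtr R (c s) := by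
  funext w
  simpa only [tsum_dirac_mul] using hc.traceInvariant_wtr hast w (dirac t) (dirac s)
    fun u => by rw [tsum_dirac_mul, tsum_dirac_mul, h]

end TraceInvariance

/-- **Compositionality of probabilistic De Simone rules.**
For every almost surely terminating probabilistic De Simone specification, trace
equivalence on the operational model is a congruence. -/
theorem stmt17 {L Op : Type} {ar : Op → ℕ}
    (R : ∀ f : Op, Set (WRule L Op ar f))
    -- the specification is probabilistic
    (hprob : ∀ t : Tm Op ar, (∑' u : (L × Tm Op ar) ⊕ Unit, gamma R t u) = 1)
    -- the specification is almost surely terminating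
    (hast : ∀ t : Tm Op ar, (∑' w : List L, wtr R t w) = 1)
    (f : Op) (ts ss : Fin (ar f) → Tm Op ar)
    (h : ∀ i, wtr R (ts i) = wtr R (ss i)) :
    wtr R (.op f ts) = wtr R (.op f ss) := by
  classical
  have replace (S : Finset (Fin (ar f))) : wtr R (.op f ts) = wtr R (.op f (S.piecewise ss ts)) := by
    induction S using Finset.induction_on with
    | empty => simp
    | insert i S hi ih =>
      rw [ih, Finset.piecewise_insert]
      have := (IsAffineCtx.op f i (S.piecewise ss ts) .hole).wtr_congr hast (h i)
      rwa [show ts i = S.piecewise ss ts i by simp [hi], Function.update_eq_self] at this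
  simpa using replace Finset.univ
end
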